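/- For every rooted digraph D with root r, every v ∈ V−r, and every u ∈ (V ∖ B_{v,D})−r, there is an r-fan P in D−rv whose set of last vertices is ent_{D−rv}(B_{v,D}) ∪ {u}. -/

import Mathlib

namespace FlamePaper

universe u
variable {V : Type u}

/-- A (nonempty, repetition-free) directed path, given by the list of its vertices;
its edge set consists of the pairs of consecutive vertices. A one-vertex list is the
trivial `v→v` path. -/
structure DiPath (V : Type u) where
  verts : List V
  ne : verts ≠ []
  nodup : verts.Nodup

namespace DiPath
variable (P : DiPath V)
def first : V := P.verts.head P.ne
def last : V := P.verts.getLast P.ne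
def vertexSet : Set V := {x | x ∈ P.verts}
def edges : Set (V × V) := {e | e ∈ P.verts.zip P.verts.tail}
def internal : Set V := P.vertexSet \ {P.first, P.last}
/-- The last edge of `P` (as a set; empty for the trivial path). -/
def lastEdge : Set (V × V) := {e ∈ P.edges | e.2 = P.last}
end DiPath

/-- `P` is a path of the digraph `D`. -/
def IsPathIn (D : Set (V × V)) (P : DiPath V) : Prop := P.edges ⊆ D

/-- `P` is an `a→b` path in `D`. -/
def IsPath (D : Set (V × V)) (a b : V) (P : DiPath V) : Prop :=
  IsPathIn D P ∧ P.first = a ∧ P.last = b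

/-- The set of ingoing edges of `v` in `D`. -/
def inEdges (D : Set (V × V)) (v : V) : Set (V × V) := {e ∈ D | e.2 = v}

/-- The set of outgoing edges of `v` in `D`. -/
def outEdges (D : Set (V × V)) (v : V) : Set (V × V) := {e ∈ D | e.1 = v}

/-- A rooted digraph: the root has no ingoing edges. -/
def IsRooted (D : Set (V × V)) (r : V) : Prop := inEdges D r = ∅

/-- `Ps` is a system of internally disjoint `r→v` paths in `D`: any two distinct
members share exactly the vertices `r` and `v`. -/
def IntDisjSystem (D : Set (V × V)) (r v : V) (Ps : Set (DiPath V)) : Prop :=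
  (∀ P ∈ Ps, IsPath D r v P) ∧
  ∀ P ∈ Ps, ∀ Q ∈ Ps, P ≠ Q → P.vertexSet ∩ Q.vertexSet = {r, v}

/-- `A_last(Ps)`: the set of last edges of the paths in `Ps`. -/
def lastEdges (Ps : Set (DiPath V)) : Set (V × V) := ⋃ P ∈ Ps, P.lastEdge

/-- `𝒢_D(v)`: the set of those `I ⊆ in_D(v)` which arise as the set of last edges
of a system of internally disjoint `r→v` paths of `D`. -/
def GSet (D : Set (V × V)) (r v : V) : Set (Set (V × V)) :=
  {I | ∃ Ps, IntDisjSystem D r v Ps ∧ lastEdges Ps = I}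

/-- `Ps ∈ ℑ_D(v)`: an internally disjoint system of `r→v` paths of `D` from each member
of which one can choose either an internal vertex or an edge so that the resulting set
meets every `r→v` path of `D`. -/
def EMSystem (D : Set (V × V)) (r v : V) (Ps : Set (DiPath V)) : Prop :=
  IntDisjSystem D r v Ps ∧
  ∃ sel : DiPath V → V ⊕ (V × V),
    (∀ P ∈ Ps, (∀ x, sel P = Sum.inl x → x ∈ P.internal) ∧
              (∀ e, sel P = Sum.inr e → e ∈ P.edges)) ∧
    ∀ Q : DiPath V, IsPath D r v Q →
      ∃ P ∈ Ps, (∀ x, sel P = Sum.inl x → x ∈ Q.vertexSet) ∧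
               (∀ e, sel P = Sum.inr e → e ∈ Q.edges)

/-- The path-system `Ps` lies in `L`. -/
def LiesIn (Ps : Set (DiPath V)) (L : Set (V × V)) : Prop := ∀ P ∈ Ps, IsPathIn L P

/-- `L` is a `D`-vertex-large spanning subdigraph of `D`. -/
def IsLarge (D L : Set (V × V)) (r : V) : Prop :=
  L ⊆ D ∧ ∀ v, v ≠ r → ∃ Ps, EMSystem D r v Ps ∧ LiesIn Ps L

/-- `F` is a vertex-flame with root `r`. -/
def IsFlame (F : Set (V × V)) (r : V) : Prop :=
  ∀ v, v ≠ r → inEdges F v ∈ GSet F r v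

/-- `F` is a quasi-vertex-flame with root `r`. -/
def IsQuasiFlame (F : Set (V × V)) (r : V) : Prop :=
  ∀ v, v ≠ r → ∀ I ⊆ inEdges F v, I.Finite → I ∈ GSet F r v

/-- `S` separates `b` from `a` in `D`: every `a→b` path of `D` meets `S`. -/
def Separates (D : Set (V × V)) (a b : V) (S : Set V) : Prop :=
  ∀ P : DiPath V, IsPath D a b P → (P.vertexSet ∩ S).Nonempty

/-- `𝔖_D(v)`: the Erdős–Menger separations corresponding to `v`. -/
def SepSet (D : Set (V × V)) (r v : V) : Set (Set V) :=
  {S | r ∉ S ∧ v ∉ S ∧ Separates (D \ {(r, v)}) r v S ∧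
    ∃ Ps, IntDisjSystem D r v Ps ∧
      ∃ sel : DiPath V → V, (∀ P ∈ Ps, sel P ∈ P.internal) ∧ S = sel '' Ps}

/-- The entrance of `X` with respect to `D`. -/
def entrance (D : Set (V × V)) (X : Set V) : Set V :=
  {v ∈ X | ∃ u, u ∉ X ∧ (u, v) ∈ D}

/-- `int_D(X) = X ∖ ent_D(X)`. -/
def interiorSet (D : Set (V × V)) (X : Set V) : Set V := X \ entrance D X

/-- `B` is a `v`-bubble of `D` (with root `r`): `B ⊆ V − r` and there is a `v`-infan
`{P_u : u ∈ ent_D(B)}` in `D ∩ (B × B)` where `P_u` starts at `u`. -/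
def IsBubble (D : Set (V × V)) (r v : V) (B : Set V) : Prop :=
  r ∉ B ∧
  ∃ F : V → DiPath V,
    (∀ u ∈ entrance D B, IsPath (D ∩ B ×ˢ B) u v (F u)) ∧
    ∀ u ∈ entrance D B, ∀ u' ∈ entrance D B, u ≠ u' →
      (F u).vertexSet ∩ (F u').vertexSet = {v}

/-- `bubb_D(v)`. -/
def bubbles (D : Set (V × V)) (r v : V) : Set (Set V) := {B | IsBubble D r v B}

/-- `B_{v,D}`: the union of all `v`-bubbles of `D`. -/
def maxBubble (D : Set (V × V)) (r v : V) : Set V := ⋃₀ bubbles D r v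

/-- `B_{S,v,D}`: the set of vertices `u` such that every `r→u` path of `D−rv` meets `S`. -/
def Bset (D : Set (V × V)) (r v : V) (S : Set V) : Set V :=
  {u | ∀ P : DiPath V, IsPath (D \ {(r, v)}) r u P → (P.vertexSet ∩ S).Nonempty}

/-- `Ps` is an `r`-fan in `D`: paths of `D` starting at `r`, any two distinct members
having only the vertex `r` in common. -/
def IsRFan (D : Set (V × V)) (r : V) (Ps : Set (DiPath V)) : Prop :=
  (∀ P ∈ Ps, IsPathIn D P ∧ P.first = r) ∧
  ∀ P ∈ Ps, ∀ Q ∈ Ps, P ≠ Q → P.vertexSet ∩ Q.vertexSet = {r}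

/-- The set of first vertices of the paths in `Ps`. -/
def Vfirst (Ps : Set (DiPath V)) : Set V := DiPath.first '' Ps

/-- The set of last vertices of the paths in `Ps`. -/
def Vlast (Ps : Set (DiPath V)) : Set V := DiPath.last '' Ps

/-- `P` is an `X→Y` path in `D`: exactly its first vertex lies in `X` and
exactly its last vertex lies in `Y`. -/
def IsXYPath (D : Set (V × V)) (X Y : Set V) (P : DiPath V) : Prop :=
  IsPathIn D P ∧ P.vertexSet ∩ X = {P.first} ∧ P.vertexSet ∩ Y = {P.last}

/-- `Ps` is a system of pairwise (vertex-)disjoint `X→Y` paths of `D`. -/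
def DisjXYSystem (D : Set (V × V)) (X Y : Set V) (Ps : Set (DiPath V)) : Prop :=
  (∀ P ∈ Ps, IsXYPath D X Y P) ∧
  ∀ P ∈ Ps, ∀ Q ∈ Ps, P ≠ Q → P.vertexSet ∩ Q.vertexSet = ∅

/-- `κ_D(r,v)`: the maximum size of a (finite) system of internally disjoint `r→v`
paths of `D`. -/
noncomputable def kappa (D : Set (V × V)) (r v : V) : ℕ :=
  sSup {n : ℕ | ∃ Ps : Set (DiPath V), IntDisjSystem D r v Ps ∧ Ps.Finite ∧ Ps.ncard = n}

/-! ### Webs and waves -/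

/-- A digraph with a source set `A` (having no ingoing edges) and a target set `B`. -/
structure Web (V : Type u) where
  E : V → V → Prop
  A : Set V
  B : Set V
  noIn : ∀ x y, E x y → y ∉ A

/-- The vertices reachable from `s` by at most `n` alternating steps along `Adj` and back along
the assignment `m` of `H`. -/
def reachStage (Adj : V → V → Prop) (H : Set V) (m : V → V) (s : V) : ℕ → Set V
  | 0 => {s}
  | n + 1 => reachStage Adj H m s n ∪
      {x | ∃ y ∈ H, m y = x ∧ ∃ x' ∈ reachStage Adj H m s n, Adj x' y}

theorem reachStage_subset {Adj : V → V → Prop} {H : Set V} {m : V → V} {s : V} (n : ℕ) :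
    reachStage Adj H m s n ⊆ insert s (m '' H) := by
  induction n with
  | zero => intro x hx; exact Or.inl hx
  | succ n ih =>
    rintro x (hx | ⟨y, hy, rfl, -⟩)
    · exact ih hx
    · exact Or.inr ⟨y, hy, rfl⟩

theorem exists_augment {Adj : V → V → Prop} {H : Set V} {m : V → V} {s : V}
    (hinj : Set.InjOn m H) (hadj : ∀ y ∈ H, Adj (m y) y) (hs : s ∉ m '' H) (n : ℕ) :
    ∀ x ∈ reachStage Adj H m s n, ∃ m' : V → V, {y | m' y ≠ m y}.Finite ∧
      Set.InjOn m' H ∧ (∀ y ∈ H, Adj (m' y) y) ∧ x ∉ m' '' H ∧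
      (∀ y ∈ H, m' y ≠ m y → m y ∈ reachStage Adj H m s n ∧ m' y ∈ reachStage Adj H m s n) := by
  classical
  induction n with
  | zero =>
    intro x hx
    refine ⟨m, by simp, hinj, hadj, ?_, fun y _ h => absurd rfl h⟩
    rw [show x = s from hx]; exact hs
  | succ n ih =>
    intro x hx
    by_cases hxn : x ∈ reachStage Adj H m s n
    · obtain ⟨m', h1, h2, h3, h4, h5⟩ := ih x hxn
      exact ⟨m', h1, h2, h3, h4, fun y hy h => ⟨Or.inl (h5 y hy h).1, Or.inl (h5 y hy h).2⟩⟩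
    · rcases hx with hx | ⟨y, hy, rfl, x', hx', hxy⟩
      · exact absurd hx hxn
      obtain ⟨m', h1, h2, h3, h4, h5⟩ := ih x' hx'
      have hmy : m' y = m y := by
        by_contra h
        exact hxn (h5 y hy h).1
      refine ⟨Function.update m' y x', ?_, ?_, ?_, ?_, ?_⟩
      · refine (h1.union (Set.finite_singleton y)).subset ?_
        intro z hz
        by_cases hzy : z = y
        · exact Or.inr hzy
        · left
          simpa [Function.update_of_ne hzy] using hz
      · intro a ha b hb hab
        by_cases hay : a = y <;> by_cases hby : b = y
        · rw [hay, hby]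
        · subst hay
          rw [Function.update_self, Function.update_of_ne hby] at hab
          exact absurd ⟨b, hb, hab.symm⟩ h4
        · subst hby
          rw [Function.update_self, Function.update_of_ne hay] at hab
          exact absurd ⟨a, ha, hab⟩ h4
        · rw [Function.update_of_ne hay, Function.update_of_ne hby] at hab
          exact h2 ha hb hab
      · intro z hz
        by_cases hzy : z = y
        · subst hzy; rwa [Function.update_self]
        · rw [Function.update_of_ne hzy]; exact h3 z hz
      · rintro ⟨z, hz, hzx⟩
        by_cases hzy : z = y
        · subst hzy
          rw [Function.update_self] at hzx
          exact hxn (hzx ▸ hx')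
        · rw [Function.update_of_ne hzy, ← hmy] at hzx
          exact hzy (h2 hz hy hzx)
      · intro z hz hne
        by_cases hzy : z = y
        · subst hzy
          rw [Function.update_self]
          exact ⟨Or.inr ⟨z, hz, rfl, x', hx', hxy⟩, Or.inl hx'⟩
        · rw [Function.update_of_ne hzy] at hne ⊢
          exact ⟨Or.inl (h5 z hz hne).1, Or.inl (h5 z hz hne).2⟩

/-- Iterating `m` from `y` either does not move or arrives in `T`. -/
def Grounded (T : Set V) (m : V → V) (y : V) : Prop := m y = y ∨ ∃ n, m^[n] y ∈ T

theorem Grounded.mono {T T' : Set V} {m : V → V} {y : V} (h : Grounded T m y) (hT : T ⊆ T') :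
    Grounded T' m y :=
  h.imp_right fun ⟨n, hn⟩ => ⟨n, hT hn⟩

theorem Grounded.congr {T D : Set V} {m m' : V → V} {y : V} (h : Grounded T m y)
    (hD : ∀ z, m' z ≠ m z → z ∈ D) : Grounded (T ∪ D) m' y := by
  rcases h with h | ⟨n, hn⟩
  · by_cases hy : m' y = m y
    · exact Or.inl (hy.trans h)
    · exact Or.inr ⟨0, Or.inr (hD y hy)⟩
  · induction n generalizing y with
    | zero => exact Or.inr ⟨0, Or.inl hn⟩
    | succ n ih =>
      by_cases hy : m' y = m y
      · rw [Function.iterate_succ_apply] at hn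
        rcases ih hn with h | ⟨k, hk⟩
        · by_cases hmm : m' y = y
          · exact Or.inl hmm
          · right
            by_cases hq : ∃ k, m'^[k] y ∈ T ∪ D
            · exact hq
            · exfalso
              have hfix : ∀ k, m^[k] (m y) = m y := by
                have h0 : m (m y) = m y := by
                  by_contra hne
                  refine hq ⟨1, Or.inr (hD _ ?_)⟩
                  rw [Function.iterate_one, hy, h]
                  exact fun e => hne e.symm
                intro k
                exact Function.iterate_fixed h0 k
              rw [hfix] at hn
              exact hq ⟨1, Or.inl (by rwa [Function.iterate_one, hy])⟩
        · refine Or.inr ⟨k + 1, ?_⟩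
          rwa [Function.iterate_succ_apply, hy]
      · exact Or.inr ⟨0, Or.inr (hD y hy)⟩

theorem iterate_mem_of_unmatched {A I H D : Set V} {m : V → V} (hI : ∀ y ∈ H, m y ∈ I)
    (hIH : I \ A ⊆ H) (hinj : Set.InjOn m H) (hD : D.Finite)
    (hg : ∀ y ∈ H, Grounded (A ∪ D) m y) {y : V} (hy : y ∈ H) (hym : y ∉ m '' H) :
    ∃ n, m^[n] y ∈ A := by
  by_contra! hA
  have hH : ∀ k, m^[k] y ∈ H := by
    intro k
    induction k with
    | zero => exact hy
    | succ k ih =>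
      have := hA (k + 1)
      rw [Function.iterate_succ_apply'] at this ⊢
      exact hIH ⟨hI _ ih, this⟩
  have hlt : ∀ j k, m^[j] y = m^[j + (k + 1)] y → False := by
    intro j k h
    induction j with
    | zero =>
      rw [zero_add, Function.iterate_succ_apply'] at h
      exact hym ⟨_, hH k, h.symm⟩
    | succ j ih =>
      rw [show j + 1 + (k + 1) = (j + (k + 1)) + 1 by ring, Function.iterate_succ_apply',
        Function.iterate_succ_apply'] at h
      exact ih (hinj (hH _) (hH _) h)
  have hfinj : Function.Injective fun k => m^[k] y := by
    intro j k h
    rcases lt_trichotomy j k with hjk | hjk | hjk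
    · obtain ⟨c, rfl⟩ := Nat.exists_eq_add_of_lt hjk
      exact (hlt j c h).elim
    · exact hjk
    · obtain ⟨c, rfl⟩ := Nat.exists_eq_add_of_lt hjk
      exact (hlt k c h.symm).elim
  have hfin : ((fun k => m^[k] y) ⁻¹' D).Finite := hD.preimage hfinj.injOn
  obtain ⟨b, hb⟩ := hfin.bddAbove
  rcases hg _ (hH (b + 1)) with h | ⟨n, hn | hn⟩
  · exact hlt (b + 1) 0 (by rw [← add_assoc, add_zero, Function.iterate_succ_apply' m (b + 1), h])
  · rw [← Function.iterate_add_apply] at hn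
    exact hA _ hn
  · rw [← Function.iterate_add_apply] at hn
    have := hb hn
    omega

theorem exists_repair {A I H D : Set V} {m : V → V} (hHA : ∀ y ∈ H, y ∉ A)
    (hI : ∀ y ∈ H, m y ∈ I) (hIH : I \ A ⊆ H) (hinj : Set.InjOn m H) (hD : D.Finite)
    (hg : ∀ y ∈ H, Grounded (A ∪ D) m y) :
    ∃ m' : V → V, Set.InjOn m' H ∧ (∀ y ∈ H, Grounded A m' y) ∧ m' '' H ⊆ m '' H ∧
      ∀ y, m' y = y ∨ m' y = m y := by
  classical
  set C : Set V := {y | ∀ n, m^[n] y ∉ A} with hC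
  set m' : V → V := fun y => if y ∈ C then y else m y with hm'
  have hm1 : ∀ y ∈ C, m' y = y := fun y hy => if_pos hy
  have hm2 : ∀ y, y ∉ C → m' y = m y := fun y hy => if_neg hy
  have hback : ∀ y, y ∉ A → m y ∈ C → y ∈ C := by
    intro y hy hmy n
    cases n with
    | zero => exact hy
    | succ n => rw [Function.iterate_succ_apply]; exact hmy n
  refine ⟨m', ?_, ?_, ?_, ?_⟩
  · intro y hy z hz h
    by_cases hyC : y ∈ C <;> by_cases hzC : z ∈ C
    · rwa [hm1 y hyC, hm1 z hzC] at h
    · rw [hm1 y hyC, hm2 z hzC] at h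
      exact absurd (hback z (hHA z hz) (h ▸ hyC)) hzC
    · rw [hm2 y hyC, hm1 z hzC] at h
      exact absurd (hback y (hHA y hy) (h ▸ hzC)) hyC
    · rw [hm2 y hyC, hm2 z hzC] at h
      exact hinj hy hz h
  · rintro y -
    by_cases hyC : y ∈ C
    · exact Or.inl (hm1 y hyC)
    · right
      have : ∃ n, m^[n] y ∈ A := by simpa [hC] using hyC
      obtain ⟨n, hn⟩ := this
      clear hyC
      induction n generalizing y with
      | zero => exact ⟨0, hn⟩
      | succ n ih =>
        have hyC : y ∉ C := fun h => h (n + 1) hn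
        rw [Function.iterate_succ_apply] at hn
        obtain ⟨k, hk⟩ := ih (m y) hn
        exact ⟨k + 1, by rwa [Function.iterate_succ_apply, hm2 _ hyC]⟩
  · rintro _ ⟨y, hy, rfl⟩
    by_cases hyC : y ∈ C
    · rw [hm1 y hyC]
      by_contra hn
      obtain ⟨n, hn⟩ := iterate_mem_of_unmatched hI hIH hinj hD hg hy hn
      exact hyC n hn
    · rw [hm2 y hyC]
      exact ⟨y, hy, rfl⟩
  · intro y
    by_cases hyC : y ∈ C
    · exact Or.inl (hm1 y hyC)
    · exact Or.inr (hm2 y hyC)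

theorem exists_glue {ι : Type*} [LinearOrder ι] [WellFoundedLT ι] {A : Set V} {H : ι → Set V}
    {m : ι → V → V} (hinj : ∀ i, Set.InjOn (m i) (H i))
    (hconf : ∀ i j, j < i → ∀ y ∈ H j, ∀ y' ∈ H i, m j y = m i y' → ∃ k < i, y' ∈ H k)
    (hmem : ∀ i, ∀ y ∈ H i, m i y ∈ A ∪ H i)
    (hg : ∀ i, ∀ y ∈ H i, Grounded A (m i) y) :
    ∃ M : V → V, Set.InjOn M (⋃ i, H i) ∧ (∀ y ∈ ⋃ i, H i, Grounded A M y) ∧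
      ∀ y ∈ ⋃ i, H i, ∃ i, y ∈ H i ∧ (∀ k < i, y ∉ H k) ∧ M y = m i y := by
  classical
  rcases isEmpty_or_nonempty ι with hι | hι
  · exact ⟨id, by simp⟩
  have hleast : ∀ y ∈ ⋃ i, H i, ∃ i, y ∈ H i ∧ ∀ k < i, y ∉ H k := by
    intro y hy
    have hy' : {i | y ∈ H i}.Nonempty := by simpa [Set.Nonempty] using hy
    obtain ⟨i, hi, hmin⟩ := wellFounded_lt.has_min _ hy'
    exact ⟨i, hi, fun k hk hyk => hmin k hyk hk⟩
  choose! l hl1 hl2 using hleast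
  have hU : ∀ i y, y ∈ H i → y ∈ ⋃ i, H i := fun i y h => Set.mem_iUnion_of_mem i h
  have hle : ∀ i y, y ∈ H i → l y ≤ i := fun i y h =>
    not_lt.1 fun hlt => hl2 y (hU i y h) i hlt h
  set M : V → V := fun y => m (l y) y with hM
  have hMinj : Set.InjOn M (⋃ i, H i) := by
    have key : ∀ y ∈ ⋃ i, H i, ∀ z ∈ ⋃ i, H i, M y = M z → ¬ l y < l z := by
      intro y hy z hz h hlt
      obtain ⟨k, hk, hzk⟩ := hconf _ _ hlt y (hl1 y hy) z (hl1 z hz) h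
      exact hl2 z hz k hk hzk
    intro y hy z hz h
    have hyz : l y = l z :=
      le_antisymm (not_lt.1 (key z hz y hy h.symm)) (not_lt.1 (key y hy z hz h))
    refine hinj (l y) (hl1 y hy) (hyz ▸ hl1 z hz) ?_
    simpa [hM, hyz] using h
  refine ⟨M, hMinj, ?_, fun y hy => ⟨l y, hl1 y hy, hl2 y hy, rfl⟩⟩
  have main : ∀ i, ∀ y, y ∈ ⋃ i, H i → l y = i → Grounded A M y := by
    intro i
    induction i using WellFoundedLT.induction with
    | _ i ihi =>
    intro y hy hyi
    have hyi' : y ∈ H i := hyi ▸ hl1 y hy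
    have hMy : ∀ y, l y = i → M y = m i y := fun y h => by simp [hM, h]
    rcases hg i y hyi' with h | ⟨n, hn⟩
    · exact Or.inl ((hMy y hyi).trans h)
    · induction n generalizing y with
      | zero => exact Or.inr ⟨0, hn⟩
      | succ n ihn =>
        rw [Function.iterate_succ_apply] at hn
        by_cases hzA : m i y ∈ A
        · exact Or.inr ⟨1, by rwa [Function.iterate_one, hMy y hyi]⟩
        have hzH : m i y ∈ H i := (hmem i y hyi').resolve_left hzA
        have hz : Grounded A M (m i y) := by
          rcases (hle i _ hzH).eq_or_lt with h | h
          · exact ihn _ (hU i _ hzH) h hzH hn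
          · exact ihi _ h _ (hU i _ hzH) rfl
        rcases hz with h | ⟨k, hk⟩
        · left
          refine hMinj (hU i _ ?_) hy ?_
          · rwa [hMy y hyi]
          · rw [hMy y hyi, h]
        · exact Or.inr ⟨k + 1, by rwa [Function.iterate_succ_apply, hMy y hyi]⟩
  exact fun y hy => main (l y) y hy rfl

namespace Web

variable {W : Web V}

/-- Equality or an edge. -/
def adj (W : Web V) (x y : V) : Prop := x = y ∨ W.E x y

/-- The web obtained by isolating the vertices of `Z` and removing them from the sources. -/
def del (W : Web V) (Z : Set V) : Web V where
  E x y := W.E x y ∧ x ∉ Z ∧ y ∉ Z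
  A := W.A \ Z
  B := W.B
  noIn x y h hy := W.noIn x y h.1 hy.1

theorem del_del (W : Web V) (Z Z' : Set V) : (W.del Z).del Z' = W.del (Z ∪ Z') := by
  simp only [del, Set.sdiff_sdiff, Set.mem_union, not_or]
  congr 1
  funext x y
  simp only [eq_iff_iff]
  tauto

theorem del_empty (W : Web V) : W.del ∅ = W := by
  simp [del]

theorem adj_of_del {Z : Set V} {x y : V} (h : (W.del Z).adj x y) : W.adj x y :=
  h.imp_right fun h => h.1

theorem adj_del {Z : Set V} {x y : V} (h : W.adj x y) (hx : x ∉ Z) (hy : y ∉ Z) :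
    (W.del Z).adj x y :=
  h.imp_right fun h => ⟨h, hx, hy⟩

/-- The vertices outside `A` equal to or dominated by a member of `I`. -/
def heads (W : Web V) (I : Set V) : Set V := {y | y ∉ W.A ∧ ∃ x ∈ I, W.adj x y}

theorem mem_heads_self {I : Set V} {x : V} (hx : x ∈ I) (hA : x ∉ W.A) : x ∈ W.heads I :=
  ⟨hA, x, hx, Or.inl rfl⟩

theorem heads_mono {I J : Set V} (h : I ⊆ J) : W.heads I ⊆ W.heads J :=
  fun _ ⟨hy, x, hx, hxy⟩ => ⟨hy, x, h hx, hxy⟩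

theorem heads_iUnion {ι : Sort*} (I : ι → Set V) : W.heads (⋃ i, I i) = ⋃ i, W.heads (I i) := by
  ext y
  simp only [heads, Set.mem_iUnion, Set.mem_ofPred_eq]
  constructor
  · rintro ⟨h, x, ⟨i, hi⟩, hx⟩
    exact ⟨i, h, x, hi, hx⟩
  · rintro ⟨i, h, x, hi, hx⟩
    exact ⟨h, x, ⟨i, hi⟩, hx⟩

theorem heads_del {I Z : Set V} (hI : Disjoint I Z) :
    (W.del Z).heads I = W.heads I \ Z := by
  ext y
  constructor
  · rintro ⟨hA, x, hx, hxy⟩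
    have hxZ : x ∉ Z := fun h => Set.disjoint_left.1 hI hx h
    have hyZ : y ∉ Z := by
      rcases hxy with rfl | h
      · exact hxZ
      · exact h.2.2
    exact ⟨⟨fun h => hA ⟨h, hyZ⟩, x, hx, adj_of_del hxy⟩, hyZ⟩
  · rintro ⟨⟨hA, x, hx, hxy⟩, hyZ⟩
    exact ⟨fun h => hA h.1, x, hx, adj_del hxy (fun h => Set.disjoint_left.1 hI hx h) hyZ⟩

/-- A set `I` avoiding `B` whose heads are injectively and well-foundedly matched into `I`: the
image of the heads separates nothing new from the sources. -/
structure IsWave (W : Web V) (I : Set V) (m : V → V) : Prop where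
  avoid : ∀ x ∈ I, x ∉ W.B
  mem : ∀ y ∈ W.heads I, m y ∈ I
  adj : ∀ y ∈ W.heads I, W.adj (m y) y
  inj : Set.InjOn m (W.heads I)
  grounded : ∀ y ∈ W.heads I, Grounded W.A m y

/-- Some wave does not use one of its vertices. -/
def Hindered (W : Web V) : Prop :=
  ∃ I m s, W.IsWave I m ∧ s ∈ I ∧ s ∉ m '' W.heads I

/-- The vertex `y` is a head of a wave. -/
def Hit (W : Web V) (y : V) : Prop := ∃ I m, W.IsWave I m ∧ y ∈ W.heads I

/-- Any vertex of `I` can be left unused by a wave on `I`. -/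
def Critical (W : Web V) (I : Set V) : Prop :=
  I.Nonempty ∧ ∀ x ∈ I, ∃ m, W.IsWave I m ∧ x ∉ m '' W.heads I

/-- A wave up to groundedness, off a finite set of exceptions, can be repaired. -/
theorem exists_isWave_of_finite {I D : Set V} {m : V → V} (hB : ∀ x ∈ I, x ∉ W.B)
    (hI : ∀ y ∈ W.heads I, m y ∈ I) (hadj : ∀ y ∈ W.heads I, W.adj (m y) y)
    (hinj : Set.InjOn m (W.heads I)) (hD : D.Finite)
    (hg : ∀ y ∈ W.heads I, Grounded (W.A ∪ D) m y) :
    ∃ m', W.IsWave I m' ∧ m' '' W.heads I ⊆ m '' W.heads I := by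
  obtain ⟨m', h1, h2, h3, h4⟩ := exists_repair (fun y hy => hy.1) hI
    (fun x hx => mem_heads_self hx.1 hx.2) hinj hD hg
  refine ⟨m', ⟨hB, ?_, ?_, h1, h2⟩, h3⟩
  · intro y hy
    obtain ⟨z, hz, hzy⟩ := h3 ⟨y, hy, rfl⟩
    exact hzy ▸ hI z hz
  · intro y hy
    rcases h4 y with h | h
    · exact Or.inl h
    · rw [h]; exact hadj y hy

theorem Hindered.exists_critical (h : W.Hindered) : ∃ I, W.Critical I := by
  obtain ⟨I, m, s, hw, hs, hsm⟩ := h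
  set R : Set V := ⋃ n, reachStage W.adj (W.heads I) m s n with hR
  have hRI : R ⊆ I := by
    intro x hx
    obtain ⟨n, hn⟩ := Set.mem_iUnion.1 hx
    rcases reachStage_subset n hn with rfl | ⟨y, hy, rfl⟩
    · exact hs
    · exact hw.mem y hy
  refine ⟨R, ⟨s, Set.mem_iUnion.2 ⟨0, rfl⟩⟩, fun x hx => ?_⟩
  obtain ⟨n, hn⟩ := Set.mem_iUnion.1 hx
  obtain ⟨m', h1, h2, h3, h4, h5⟩ := exists_augment hw.inj hw.adj hsm n x hn
  have hsub : W.heads R ⊆ W.heads I := heads_mono hRI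
  have hmem : ∀ y ∈ W.heads R, m' y ∈ R := by
    intro y hy
    by_cases he : m' y = m y
    · rw [he]
      obtain ⟨-, x', hx', hxy⟩ := id hy
      obtain ⟨k, hk⟩ := Set.mem_iUnion.1 hx'
      exact Set.mem_iUnion.2 ⟨k + 1, Or.inr ⟨y, hsub hy, rfl, x', hk, hxy⟩⟩
    · exact Set.mem_iUnion.2 ⟨n, (h5 y (hsub hy) he).2⟩
  obtain ⟨m'', hw'', him⟩ := exists_isWave_of_finite (fun x hx => hw.avoid x (hRI hx)) hmem
    (fun y hy => h3 y (hsub hy)) (h2.mono hsub) h1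
    (fun y hy => (hw.grounded y (hsub hy)).congr fun z hz => hz)
  exact ⟨m'', hw'', fun hx => h4 (Set.image_mono hsub (him hx))⟩

theorem Critical.disjoint {I Z : Set V} (h : (W.del Z).Critical I) : Disjoint I Z := by
  rw [Set.disjoint_left]
  intro x hx hxZ
  obtain ⟨m, hm, hxm⟩ := h.2 x hx
  have hxh : x ∈ (W.del Z).heads I := mem_heads_self hx fun h => h.2 hxZ
  refine hxm ⟨x, hxh, ?_⟩
  rcases hm.adj x hxh with h | h
  · exact h
  · exact absurd hxZ h.2.2

theorem IsWave.of_del {I Z : Set V} {m : V → V} (h : (W.del Z).IsWave I m) (hIZ : Disjoint I Z)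
    (hH : Disjoint (W.heads I) Z) : W.IsWave I m := by
  have he : (W.del Z).heads I = W.heads I := by
    rw [heads_del hIZ, sdiff_eq_left.2 hH]
  obtain ⟨h1, h2, h3, h4, h5⟩ := h
  rw [he] at h2 h3 h4 h5
  exact ⟨h1, h2, fun y hy => adj_of_del (h3 y hy), h4, fun y hy => (h5 y hy).mono fun x hx => hx.1⟩

theorem not_hindered_del_source (h : ¬ W.Hindered) {a : V} (ha : a ∈ W.A) :
    ¬ (W.del {a}).Hindered := by
  intro hh
  obtain ⟨I, hI⟩ := hh.exists_critical
  have hH : Disjoint (W.heads I) {a} := by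
    rw [Set.disjoint_singleton_right]
    exact fun h => h.1 ha
  obtain ⟨s, hs⟩ := hI.1
  obtain ⟨m, hm, hsm⟩ := hI.2 s hs
  rw [heads_del hI.disjoint, sdiff_eq_left.2 hH] at hsm
  exact h ⟨I, m, s, hm.of_del hI.disjoint hH, hs, hsm⟩

theorem hit_of_hindered_del (h : ¬ W.Hindered) {x : V} (hxA : x ∉ W.A)
    (hh : (W.del {x}).Hindered) : W.Hit x := by
  classical
  obtain ⟨I, hI⟩ := hh.exists_critical
  have hd := hI.disjoint
  have hxI : x ∉ I := fun h => Set.disjoint_left.1 hd h rfl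
  by_cases hx : x ∈ W.heads I
  · obtain ⟨-, x0, hx0, hadj⟩ := id hx
    obtain ⟨m, hm, hx0m⟩ := hI.2 x0 hx0
    rw [heads_del hd] at hx0m
    have hm2 := hm.mem
    have hm3 := hm.adj
    have hm4 := hm.inj
    have hm5 := hm.grounded
    rw [heads_del hd] at hm2 hm3 hm4 hm5
    refine Exists.elim (exists_isWave_of_finite (W := W) (I := I) (D := {x})
      (m := Function.update m x x0) hm.avoid ?_ ?_ ?_ (Set.finite_singleton x) ?_)
      fun m' hw => ⟨I, m', hw.1, hx⟩
    · intro y hy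
      by_cases hyx : y = x
      · subst hyx; rwa [Function.update_self]
      · rw [Function.update_of_ne hyx]; exact hm2 y ⟨hy, hyx⟩
    · intro y hy
      by_cases hyx : y = x
      · subst hyx; rwa [Function.update_self]
      · rw [Function.update_of_ne hyx]; exact adj_of_del (hm3 y ⟨hy, hyx⟩)
    · intro y hy z hz hyz
      by_cases hyx : y = x <;> by_cases hzx : z = x
      · rw [hyx, hzx]
      · subst hyx
        rw [Function.update_self, Function.update_of_ne hzx] at hyz
        exact absurd ⟨z, ⟨hz, hzx⟩, hyz.symm⟩ hx0m
      · subst hzx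
        rw [Function.update_self, Function.update_of_ne hyx] at hyz
        exact absurd ⟨y, ⟨hy, hyx⟩, hyz⟩ hx0m
      · rw [Function.update_of_ne hyx, Function.update_of_ne hzx] at hyz
        exact hm4 ⟨hy, hyx⟩ ⟨hz, hzx⟩ hyz
    · intro y hy
      by_cases hyx : y = x
      · exact Or.inr ⟨0, Or.inr hyx⟩
      · refine ((hm5 y ⟨hy, hyx⟩).mono fun x hx => hx.1).congr fun z hz => ?_
        by_contra hzx
        exact hz (Function.update_of_ne hzx _ _)
  · exfalso
    have hH : Disjoint (W.heads I) {x} := by rwa [Set.disjoint_singleton_right]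
    obtain ⟨s, hs⟩ := hI.1
    obtain ⟨m, hm, hsm⟩ := hI.2 s hs
    rw [heads_del hd, sdiff_eq_left.2 hH] at hsm
    exact h ⟨I, m, s, hm.of_del hd hH, hs, hsm⟩

theorem heads_del_of_mem {I : Set V} {m : V → V} {z : V}
    (hmem : ∀ y ∈ W.heads I \ {z}, m y ∈ I \ {z}) (hadj : ∀ y ∈ W.heads I \ {z}, W.adj (m y) y) :
    (W.del {z}).heads (I \ {z}) = W.heads I \ {z} := by
  rw [heads_del Set.disjoint_sdiff_left]
  refine subset_antisymm (Set.sdiff_subset_sdiff_left (heads_mono Set.sdiff_subset)) ?_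
  intro y hy
  exact ⟨⟨hy.1.1, m y, hmem y hy, hadj y hy⟩, hy.2⟩

theorem IsWave.exists_del {I : Set V} {m : V → V} (hw : W.IsWave I m) {z : V} (hzA : z ∉ W.A)
    (hz : ¬ (W.del {z}).Hindered) :
    ∃ m', (W.del {z}).IsWave (I \ {z}) m' ∧ (W.del {z}).heads (I \ {z}) = W.heads I \ {z} := by
  classical
  have hA : (W.del {z}).A = W.A := by simp [del, hzA]
  by_cases hcase : ∀ y ∈ W.heads I \ {z}, m y ≠ z
  · have hmem : ∀ y ∈ W.heads I \ {z}, m y ∈ I \ {z} :=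
      fun y hy => ⟨hw.mem y hy.1, hcase y hy⟩
    have he := heads_del_of_mem hmem fun y hy => hw.adj y hy.1
    refine ⟨m, ⟨fun x hx => hw.avoid x hx.1, ?_, ?_, ?_, ?_⟩, he⟩ <;> rw [he]
    · exact hmem
    · exact fun y hy => adj_del (hw.adj y hy.1) (hmem y hy).2 hy.2
    · exact hw.inj.mono Set.sdiff_subset
    · rw [hA]; exact fun y hy => hw.grounded y hy.1
  push Not at hcase
  obtain ⟨w, ⟨hwH, hwz⟩, hmw⟩ := hcase
  have hzI : z ∈ I := hmw ▸ hw.mem w hwH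
  have hzH : z ∈ W.heads I := mem_heads_self hzI hzA
  have hpz : m z ≠ z := fun h => hwz (hw.inj hwH hzH (hmw.trans h.symm))
  set H0 : Set V := W.heads I \ {z, w} with hH0
  have hH0sub : H0 ⊆ W.heads I := Set.sdiff_subset
  have hp : m z ∉ m '' H0 := by
    rintro ⟨y, hy, hyz⟩
    exact hy.2 (Or.inl (hw.inj hy.1 hzH hyz))
  have hm0 : ∀ y ∈ H0, m y ∈ I \ {z} := by
    intro y hy
    refine ⟨hw.mem y hy.1, fun h => hy.2 (Or.inr ?_)⟩
    exact hw.inj hy.1 hwH (Eq.trans h hmw.symm)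
  set R : Set V := ⋃ n, reachStage W.adj H0 m (m z) n with hR
  have hRI : R ⊆ I \ {z} := by
    intro x hx
    obtain ⟨n, hn⟩ := Set.mem_iUnion.1 hx
    rcases reachStage_subset n hn with rfl | ⟨y, hy, rfl⟩
    · exact ⟨hw.mem z hzH, hpz⟩
    · exact hm0 y hy
  have hdisj : Disjoint R {z} := Set.disjoint_singleton_right.2 fun h => (hRI h).2 rfl
  by_cases hB : ∃ x ∈ R, W.adj x w
  · obtain ⟨x, hx, hxw⟩ := hB
    obtain ⟨n, hn⟩ := Set.mem_iUnion.1 hx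
    obtain ⟨m', h1, h2, h3, h4, h5⟩ := exists_augment (hw.inj.mono hH0sub)
      (fun y hy => hw.adj y (hH0sub hy)) hp n x hn
    set m1 := Function.update m' w x with hm1
    have hm1w : m1 w = x := Function.update_self ..
    have hm1n : ∀ y, y ≠ w → m1 y = m' y := fun y h => Function.update_of_ne h ..
    have hH1 : ∀ y ∈ W.heads I \ {z}, y ≠ w → y ∈ H0 := by
      intro y hy hyw
      exact ⟨hy.1, by rintro (h | h); exacts [hy.2 h, hyw h]⟩
    have hmem : ∀ y ∈ W.heads I \ {z}, m1 y ∈ I \ {z} := by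
      intro y hy
      by_cases hyw : y = w
      · rw [hyw, hm1w]; exact hRI hx
      · rw [hm1n y hyw]
        by_cases he : m' y = m y
        · rw [he]; exact hm0 y (hH1 y hy hyw)
        · exact hRI (Set.mem_iUnion.2 ⟨n, (h5 y (hH1 y hy hyw) he).2⟩)
    have hadj : ∀ y ∈ W.heads I \ {z}, W.adj (m1 y) y := by
      intro y hy
      by_cases hyw : y = w
      · rw [hyw, hm1w]; exact hxw
      · rw [hm1n y hyw]; exact h3 y (hH1 y hy hyw)
    have he := heads_del_of_mem hmem hadj
    have hfin := h1.union (Set.finite_singleton w)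
    refine Exists.elim (exists_isWave_of_finite (W := W.del {z}) (I := I \ {z}) (m := m1)
      (fun x hx => hw.avoid x hx.1) (he ▸ hmem)
      (he ▸ fun y hy => adj_del (hadj y hy) (hmem y hy).2 hy.2) ?_ hfin ?_)
      fun m'' hw'' => ⟨m'', hw''.1, he⟩
    · rw [he]
      intro a ha b hb hab
      by_cases hay : a = w <;> by_cases hby : b = w
      · rw [hay, hby]
      · rw [hay, hm1w, hm1n b hby] at hab
        exact absurd ⟨b, hH1 b hb hby, hab.symm⟩ h4
      · rw [hby, hm1w, hm1n a hay] at hab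
        exact absurd ⟨a, hH1 a ha hay, hab⟩ h4
      · rw [hm1n a hay, hm1n b hby] at hab
        exact h2 (hH1 a ha hay) (hH1 b hb hby) hab
    · rw [he, hA]
      intro y hy
      refine (hw.grounded y hy.1).congr fun t ht => ?_
      by_cases htw : t = w
      · exact Or.inr htw
      · exact Or.inl (by rwa [hm1n t htw] at ht)
  · exfalso
    push Not at hB
    have hsub : (W.del {z}).heads R ⊆ H0 := by
      rw [heads_del hdisj]
      rintro y ⟨hy, hyz⟩
      refine ⟨heads_mono (fun x hx => (hRI hx).1) hy, ?_⟩
      rintro (h | h)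
      · exact hyz h
      · obtain ⟨-, x, hx, hxy⟩ := hy
        exact hB x hx (h ▸ hxy)
    refine hz ⟨R, m, m z, ⟨fun x hx => hw.avoid x (hRI hx).1, ?_, ?_, ?_, ?_⟩,
      Set.mem_iUnion.2 ⟨0, rfl⟩, fun h => hp (Set.image_mono hsub h)⟩
    · intro y hy
      obtain ⟨-, x', hx', hxy⟩ := id hy
      obtain ⟨k, hk⟩ := Set.mem_iUnion.1 hx'
      exact Set.mem_iUnion.2 ⟨k + 1, Or.inr ⟨y, hsub hy, rfl, x', hk, adj_of_del hxy⟩⟩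
    · intro y hy
      exact adj_del (hw.adj y (hH0sub (hsub hy))) (hm0 y (hsub hy)).2
        (fun h => (hsub hy).2 (Or.inl h))
    · exact hw.inj.mono (hsub.trans hH0sub)
    · rw [hA]
      exact fun y hy => hw.grounded y (hH0sub (hsub hy))

theorem Hit.del_finset {F : Finset V} (hF : ∀ x ∈ F, x ∉ W.A)
    (hun : ∀ G ⊆ F, ¬ (W.del ↑G).Hindered) {y : V} (hy : W.Hit y) (hyF : y ∉ F) :
    (W.del ↑F).Hit y := by
  classical
  induction F using Finset.induction_on with
  | empty => simpa [del_empty] using hy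
  | insert z F hz ih =>
    have hF' : F ⊆ insert z F := Finset.subset_insert z F
    obtain ⟨I, m, hw, hyI⟩ := ih (fun x hx => hF x (hF' hx)) (fun G hG => hun G (hG.trans hF'))
      fun h => hyF (hF' h)
    have hset : (W.del ↑F).del {z} = W.del ↑(insert z F) := by
      rw [del_del]; congr 1; ext; simp
    obtain ⟨m', hw', he⟩ := hw.exists_del (z := z)
      (fun h => hF z (Finset.mem_insert_self z F) h.1) (hset ▸ hun _ subset_rfl)
    rw [hset] at hw' he
    refine ⟨_, m', hw', he ▸ ⟨hyI, fun h => hyF ?_⟩⟩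
    rw [show y = z from h]
    exact Finset.mem_insert_self z F

theorem exists_isWave_iUnion {ι : Type*} {I : ι → Set V} (h : ∀ i, ∃ m, W.IsWave (I i) m) :
    ∃ M, W.IsWave (⋃ i, I i) M := by
  obtain ⟨_, _⟩ := exists_wellFoundedLT ι
  choose m hm using h
  refine Exists.elim (exists_glue (A := W.A) (H := fun i => W.heads (I i)) (m := m)
    (fun i => (hm i).inj) ?_ ?_ fun i => (hm i).grounded) ?_
  rotate_left 2
  · rintro M ⟨h1, h2, h3⟩
    refine ⟨M, ⟨?_, ?_, ?_, ?_, ?_⟩⟩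
    · intro x hx
      obtain ⟨i, hi⟩ := Set.mem_iUnion.1 hx
      exact (hm i).avoid x hi
    all_goals rw [heads_iUnion]
    · intro y hy
      obtain ⟨i, hi, -, he⟩ := h3 y hy
      exact Set.mem_iUnion.2 ⟨i, he ▸ (hm i).mem y hi⟩
    · intro y hy
      obtain ⟨i, hi, -, he⟩ := h3 y hy
      exact he ▸ (hm i).adj y hi
    · exact h1
    · exact h2
  · intro i j hji y hy y' hy' hyy
    exact ⟨j, hji, hy'.1, m j y, (hm j).mem y hy, hyy ▸ (hm i).adj y' hy'⟩
  · intro i y hy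
    by_cases hA : m i y ∈ W.A
    · exact Or.inl hA
    · exact Or.inr (mem_heads_self ((hm i).mem y hy) hA)

/-- The union of all waves. -/
def maxWave (W : Web V) : Set V := {x | ∃ I m, W.IsWave I m ∧ x ∈ I}

theorem exists_isWave_maxWave (W : Web V) : ∃ m, W.IsWave W.maxWave m := by
  have : W.maxWave = ⋃ i : {I : Set V // ∃ m, W.IsWave I m}, i.1 := by
    ext x
    simp only [maxWave, Set.mem_ofPred_eq, Set.mem_iUnion, Subtype.exists, exists_prop]
    constructor
    · rintro ⟨I, m, h, hx⟩
      exact ⟨I, ⟨m, h⟩, hx⟩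
    · rintro ⟨I, ⟨m, h⟩, hx⟩
      exact ⟨I, m, h, hx⟩
  rw [this]
  exact exists_isWave_iUnion fun i => i.2

theorem mem_heads_maxWave {y : V} : y ∈ W.heads W.maxWave ↔ W.Hit y := by
  constructor
  · intro h
    obtain ⟨m, hm⟩ := W.exists_isWave_maxWave
    exact ⟨_, m, hm, h⟩
  · rintro ⟨I, m, hw, hy⟩
    have hsub : I ⊆ W.maxWave := fun x hx => ⟨I, m, hw, hx⟩
    exact heads_mono hsub hy

end Web

open Cardinal in
theorem mk_iUnion_le_of_le {ι : Type u} {μ : Cardinal.{u}} (hμ : ℵ₀ ≤ μ) {f : ι → Set V}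
    (hι : #ι ≤ μ) (h : ∀ i, #(f i) ≤ μ) : #(⋃ i, f i : Set V) ≤ μ := by
  refine (mk_iUnion_le_sum_mk).trans ((sum_le_mk_mul_iSup _).trans ?_)
  exact (mul_le_mul' hι (ciSup_le' h)).trans (mul_eq_self hμ).le

open Cardinal in
theorem mk_union_le_of_le {μ : Cardinal.{u}} (hμ : ℵ₀ ≤ μ) {s t : Set V}
    (hs : #s ≤ μ) (ht : #t ≤ μ) : #(s ∪ t : Set V) ≤ μ :=
  (mk_union_le s t).trans ((add_le_add hs ht).trans (add_eq_self hμ).le)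

open Cardinal in
theorem mk_finset_le_of_le {α : Type u} {μ : Cardinal.{u}} (hμ : ℵ₀ ≤ μ) (h : #α ≤ μ) :
    #(Finset α) ≤ μ := by
  rcases finite_or_infinite α with hα | hα
  · have : Fintype α := Fintype.ofFinite α
    exact ((mk_lt_aleph0).le).trans hμ
  · rwa [mk_finset_of_infinite]

/-- `M` is closed under the operator `Φ`. -/
def ClosedUnder (Φ : Finset V → Set V) (M : Set V) : Prop := ∀ s : Finset V, ↑s ⊆ M → Φ s ⊆ M

/-- The smallest superset of `X` closed under `Φ`. -/
def clos (Φ : Finset V → Set V) (X : Set V) : Set V := ⋂₀ {M | X ⊆ M ∧ ClosedUnder Φ M}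

theorem subset_clos (Φ : Finset V → Set V) (X : Set V) : X ⊆ clos Φ X :=
  Set.subset_sInter fun _ hM => hM.1

theorem closedUnder_clos (Φ : Finset V → Set V) (X : Set V) : ClosedUnder Φ (clos Φ X) :=
  fun s hs => Set.subset_sInter fun _ hM => hM.2 s (hs.trans (Set.sInter_subset_of_mem hM))

theorem clos_subset {Φ : Finset V → Set V} {X M : Set V} (h : X ⊆ M) (hM : ClosedUnder Φ M) :
    clos Φ X ⊆ M :=
  Set.sInter_subset_of_mem ⟨h, hM⟩

theorem clos_mono {Φ : Finset V → Set V} {X Y : Set V} (h : X ⊆ Y) : clos Φ X ⊆ clos Φ Y :=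
  clos_subset (h.trans (subset_clos Φ Y)) (closedUnder_clos Φ Y)

theorem exists_subset_of_chain {ι : Type*} [LinearOrder ι] [Nonempty ι] {S : ι → Set V}
    (hS : Monotone S) (s : Finset V) (hs : (s : Set V) ⊆ ⋃ n, S n) :
    ∃ n, (s : Set V) ⊆ S n := by
  have hd : Directed (· ⊆ ·) S := hS.directed_le
  exact hd.exists_mem_subset_of_finset_subset_biUnion hs

theorem closedUnder_iUnion_nat {Φ : Finset V → Set V} {S : ℕ → Set V} (hS : Monotone S)
    (h : ∀ n (s : Finset V), ↑s ⊆ S n → Φ s ⊆ S (n + 1)) : ClosedUnder Φ (⋃ n, S n) := by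
  intro s hs
  obtain ⟨n, hn⟩ := exists_subset_of_chain hS s hs
  exact (h n s hn).trans (Set.subset_iUnion S (n + 1))

/-- All values of `Φ` on finite subsets of `S`. -/
def values (Φ : Finset V → Set V) (S : Set V) : Set V :=
  ⋃ s : Finset S, Φ (s.map ⟨_, Subtype.val_injective⟩)

theorem subset_values {Φ : Finset V → Set V} {S : Set V} {s : Finset V} (hs : (s : Set V) ⊆ S) :
    Φ s ⊆ values Φ S := by
  classical
  refine fun x hx => Set.mem_iUnion.2 ⟨s.subtype (· ∈ S), ?_⟩
  convert hx
  exact Finset.subtype_map_of_mem hs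

open Cardinal in
theorem mk_values_le {Φ : Finset V → Set V} {S : Set V} {μ : Cardinal.{u}} (hμ : ℵ₀ ≤ μ)
    (hS : #S ≤ μ) (hΦ : ∀ s, #(Φ s) ≤ μ) : #(values Φ S) ≤ μ :=
  mk_iUnion_le_of_le hμ (mk_finset_le_of_le hμ hS) fun _ => hΦ _

open Cardinal in
theorem mk_iUnion_nat_le_of_le {μ : Cardinal.{u}} (hμ : ℵ₀ ≤ μ) {f : ℕ → Set V}
    (h : ∀ i, #(f i) ≤ μ) : #(⋃ i, f i : Set V) ≤ μ := by
  have : (⋃ i, f i : Set V) = ⋃ i : ULift.{u} ℕ, f i.down := by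
    ext x; simp
  rw [this]
  exact mk_iUnion_le_of_le hμ (by simpa using hμ) fun i => h _

open Cardinal in
theorem mk_clos_le {Φ : Finset V → Set V} {X : Set V} {μ : Cardinal.{u}} (hμ : ℵ₀ ≤ μ)
    (hX : #X ≤ μ) (hΦ : ∀ s, #(Φ s) ≤ μ) : #(clos Φ X) ≤ μ := by
  set S : ℕ → Set V := fun n => Nat.rec X (fun _ S => S ∪ values Φ S) n with hS
  have hS1 : ∀ n, S (n + 1) = S n ∪ values Φ (S n) := fun n => rfl
  have hmono : Monotone S := monotone_nat_of_le_succ fun n => by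
    rw [hS1]; exact Set.subset_union_left
  have hcard : ∀ n, #(S n) ≤ μ := by
    intro n
    induction n with
    | zero => exact hX
    | succ n ih => rw [hS1]; exact mk_union_le_of_le hμ ih (mk_values_le hμ ih hΦ)
  have hsub : clos Φ X ⊆ ⋃ n, S n :=
    clos_subset (Set.subset_iUnion S 0) (closedUnder_iUnion_nat hmono fun n s hs => by
      rw [hS1]; exact (subset_values hs).trans Set.subset_union_right)
  exact (mk_le_mk_of_subset hsub).trans (mk_iUnion_nat_le_of_le hμ hcard)

open Cardinal in
theorem mk_Iio_ord_lt {c : Cardinal.{u}} (i : c.ord.ToType) : #(Set.Iio i) < c := by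
  have := mk_Iio_lt i (by simp)
  rwa [mk_ord_toType] at this

open Cardinal in
theorem mk_Iic_toType_ord_lt {c : Cardinal.{u}} (hc : ℵ₀ ≤ c) (i : c.ord.ToType) :
    #(Set.Iic i) < c := by
  rw [← Set.Iio_insert]
  refine (mk_insert_le).trans_lt (add_lt_of_lt hc (mk_Iio_ord_lt i) ?_)
  exact one_lt_aleph0.trans_le hc

namespace Web
variable {W : Web V}

/-- The largest wave after the deletion of `F`, without the vertices of `F`. -/
def waveOff (W : Web V) (F : Finset V) : Set V := (W.del ↑F).maxWave \ ↑F

theorem IsWave.diff {I Z : Set V} {m : V → V} (h : (W.del Z).IsWave I m) :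
    (W.del Z).IsWave (I \ Z) m ∧ (W.del Z).heads (I \ Z) = (W.del Z).heads I \ Z := by
  have hnot : ∀ y ∉ Z, ∀ x, (W.del Z).adj x y → x ∉ Z := by
    rintro y hy x (rfl | hxy)
    · exact hy
    · exact hxy.2.1
  have hsub : (W.del Z).heads (I \ Z) ⊆ (W.del Z).heads I := heads_mono Set.sdiff_subset
  have hZ : ∀ y ∈ (W.del Z).heads (I \ Z), y ∉ Z := by
    rintro y ⟨-, x, hx, rfl | hxy⟩
    · exact hx.2
    · exact hxy.2.2
  refine ⟨⟨fun x hx => h.avoid x hx.1, fun y hy => ⟨h.mem y (hsub hy), ?_⟩,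
    fun y hy => h.adj y (hsub hy), h.inj.mono hsub, fun y hy => h.grounded y (hsub hy)⟩, ?_⟩
  · exact hnot y (hZ y hy) _ (h.adj y (hsub hy))
  · refine subset_antisymm (fun y hy => ⟨hsub hy, hZ y hy⟩) ?_
    rintro y ⟨⟨hA, x, hx, hxy⟩, hyZ⟩
    exact ⟨hA, x, ⟨hx, hnot y hyZ x hxy⟩, hxy⟩

theorem exists_isWave_waveOff (W : Web V) (F : Finset V) :
    ∃ m, (W.del ↑F).IsWave (W.waveOff F) m := by
  obtain ⟨m, hm⟩ := (W.del ↑F).exists_isWave_maxWave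
  exact ⟨m, hm.diff.1⟩

theorem mem_heads_waveOff {F : Finset V} {y : V} :
    y ∈ (W.del ↑F).heads (W.waveOff F) ↔ (W.del ↑F).Hit y ∧ y ∉ F := by
  obtain ⟨m, hm⟩ := (W.del ↑F).exists_isWave_maxWave
  rw [waveOff, hm.diff.2, ← mem_heads_maxWave]
  rfl

theorem mem_heads_waveOff_of_adj {F : Finset V} {x y : V} (hx : x ∈ W.waveOff F) (hy : y ∉ W.A)
    (hyF : y ∉ F) (hxy : W.adj x y) : y ∈ (W.del ↑F).heads (W.waveOff F) :=
  ⟨fun h => hy h.1, x, hx, adj_del hxy hx.2 hyF⟩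

theorem not_mem_source_of_mem_heads_waveOff {F : Finset V} {y : V}
    (h : y ∈ (W.del ↑F).heads (W.waveOff F)) : y ∉ W.A :=
  fun hA => h.1 ⟨hA, (mem_heads_waveOff.1 h).2⟩

theorem mem_heads_waveOff_of_subset {τ : Set V} (hτA : ∀ x ∈ τ, x ∉ W.A)
    (hun : ∀ F : Finset V, ↑F ⊆ τ → ¬ (W.del ↑F).Hindered) {F F' : Finset V} (hF : F ⊆ F')
    (hF' : ↑F' ⊆ τ) {y : V} (hy : y ∈ (W.del ↑F).heads (W.waveOff F)) (hyF : y ∉ F') :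
    y ∈ (W.del ↑F').heads (W.waveOff F') := by
  classical
  rw [mem_heads_waveOff] at hy ⊢
  have hset : ∀ G : Finset V, (W.del ↑F).del ↑G = W.del ↑(F ∪ G) := fun G => by
    rw [del_del, Finset.coe_union]
  have := hy.1.del_finset (F := F') (fun x hx (h : x ∈ W.A \ ↑F) => hτA x (hF' hx) h.1)
    (fun G hG => by
      rw [hset]
      refine hun _ ?_
      rw [Finset.coe_union]
      exact Set.union_subset ((Finset.coe_subset.2 hF).trans hF')
        ((Finset.coe_subset.2 hG).trans hF')) hyF
  rw [hset, Finset.union_eq_right.2 hF] at this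
  exact ⟨this, hyF⟩

/-- The union of the sets `waveOff` over the finite subsets of `σ`. -/
def waveUnion (W : Web V) (σ : Set V) : Set V := ⋃ F : {F : Finset V // ↑F ⊆ σ}, W.waveOff F.1

/-- The set `σ` with all heads of the waves avoiding a finite subset of `σ`. -/
def headUnion (W : Web V) (σ : Set V) : Set V :=
  σ ∪ ⋃ F : {F : Finset V // ↑F ⊆ σ}, (W.del ↑F.1).heads (W.waveOff F.1)

theorem headUnion_mono {σ σ' : Set V} (h : σ ⊆ σ') : W.headUnion σ ⊆ W.headUnion σ' := by
  refine Set.union_subset_union h (Set.iUnion_subset fun F => ?_)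
  exact Set.subset_iUnion (fun F : {F : Finset V // ↑F ⊆ σ'} => (W.del ↑F.1).heads (W.waveOff F.1))
    ⟨F.1, F.2.trans h⟩

theorem mem_waveUnion {σ : Set V} {x : V} :
    x ∈ W.waveUnion σ ↔ ∃ F : Finset V, ↑F ⊆ σ ∧ x ∈ W.waveOff F := by
  simp [waveUnion]

theorem mem_headUnion {σ : Set V} {x : V} : x ∈ W.headUnion σ ↔
    x ∈ σ ∨ ∃ F : Finset V, ↑F ⊆ σ ∧ x ∈ (W.del ↑F).heads (W.waveOff F) := by
  simp [headUnion]

theorem mem_headUnion_of_adj {σ : Set V} {x y : V} (hx : x ∈ W.waveUnion σ) (hy : y ∉ W.A)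
    (hxy : W.adj x y) : y ∈ W.headUnion σ := by
  obtain ⟨F, hF, hx⟩ := mem_waveUnion.1 hx
  rw [mem_headUnion]
  by_cases hyF : y ∈ F
  · exact Or.inl (hF hyF)
  · exact Or.inr ⟨F, hF, mem_heads_waveOff_of_adj hx hy hyF hxy⟩

theorem not_mem_source_of_mem_headUnion {σ : Set V} (hσA : ∀ x ∈ σ, x ∉ W.A) {y : V}
    (h : y ∈ W.headUnion σ) : y ∉ W.A := by
  rcases mem_headUnion.1 h with h | ⟨F, -, h⟩
  · exact hσA y h
  · exact not_mem_source_of_mem_heads_waveOff h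

/-- A matching of `headUnion σ` into `waveUnion σ` that may fix vertices of `σ`. -/
structure IsMatch (W : Web V) (σ : Set V) (m : V → V) : Prop where
  inj : Set.InjOn m (W.headUnion σ)
  adj : ∀ y ∈ W.headUnion σ, W.adj (m y) y
  grounded : ∀ y ∈ W.headUnion σ, Grounded W.A m y
  mem : ∀ y ∈ W.headUnion σ, m y ∈ W.waveUnion σ ∨ m y = y ∧ y ∈ σ

theorem exists_isMatch_of_countable {τ σ : Set V} (hτA : ∀ x ∈ τ, x ∉ W.A)
    (hun : ∀ F : Finset V, ↑F ⊆ τ → ¬ (W.del ↑F).Hindered) (hστ : σ ⊆ τ) (hσ : σ.Countable) :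
    ∃ m, W.IsMatch σ m := by
  classical
  obtain ⟨S, hSmono, hSfin, hSU⟩ : ∃ S : ℕ → Set V, Monotone S ∧ (∀ n, (S n).Finite) ∧
      ⋃ n, S n = σ := by
    rcases σ.eq_empty_or_nonempty with rfl | hne
    · exact ⟨fun _ => ∅, fun _ _ _ => le_rfl, fun _ => Set.finite_empty, by simp⟩
    · obtain ⟨f, rfl⟩ := hσ.exists_eq_range hne
      refine ⟨fun n => f '' Set.Iic n, fun i j h => Set.image_mono (Set.Iic_subset_Iic.2 h),
        fun n => (Set.finite_Iic n).image f, ?_⟩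
      ext x
      simp only [Set.mem_iUnion, Set.mem_image, Set.mem_range, Set.mem_Iic]
      exact ⟨fun ⟨n, k, _, h⟩ => ⟨k, h⟩, fun ⟨k, h⟩ => ⟨k, k, le_rfl, h⟩⟩
  set F : ℕ → Finset V := fun n => (hSfin n).toFinset with hFdef
  have hFS : ∀ n, (F n : Set V) = S n := fun n => Set.Finite.coe_toFinset _
  have hFσ : ∀ n, (F n : Set V) ⊆ σ := fun n => by
    rw [hFS, ← hSU]; exact Set.subset_iUnion S n
  have hFmono : ∀ i j, i ≤ j → F i ⊆ F j := fun i j h => by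
    rw [← Finset.coe_subset, hFS, hFS]; exact hSmono h
  choose m hm using fun n => W.exists_isWave_waveOff (F n)
  set H : WithTop ℕ → Set V := fun i =>
    i.recTopCoe σ fun n => (W.del ↑(F n)).heads (W.waveOff (F n)) with hH
  set mm : WithTop ℕ → V → V := fun i => i.recTopCoe id m with hmm
  have hun' : ⋃ i, H i = W.headUnion σ := by
    ext y
    rw [mem_headUnion, Set.mem_iUnion]
    constructor
    · rintro ⟨i, hi⟩
      induction i using WithTop.recTopCoe with
      | top => exact Or.inl hi
      | coe n => exact Or.inr ⟨F n, hFσ n, hi⟩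
    · rintro (hy | ⟨G, hG, hy⟩)
      · exact ⟨⊤, hy⟩
      · obtain ⟨n, hn⟩ := exists_subset_of_chain hSmono G (hSU.symm ▸ hG)
        by_cases hyF : y ∈ F n
        · exact ⟨⊤, hFσ n hyF⟩
        · refine ⟨(n : WithTop ℕ), mem_heads_waveOff_of_subset hτA hun ?_
            ((hFσ n).trans hστ) hy hyF⟩
          rw [← Finset.coe_subset, hFS]
          exact hn
  refine Exists.elim (exists_glue (A := W.A) (H := H) (m := mm) ?_ ?_ ?_ ?_) ?_
  · intro i
    induction i using WithTop.recTopCoe with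
    | top => exact Set.injOn_id σ
    | coe n => exact (hm n).inj
  · intro i j hji y hy y' hy' he
    induction j using WithTop.recTopCoe with
    | top => exact absurd hji not_top_lt
    | coe n =>
      have hx : m n y ∈ W.waveOff (F n) := (hm n).mem y hy
      refine ⟨n, hji, ?_⟩
      induction i using WithTop.recTopCoe with
      | top =>
        have he' : m n y = y' := he
        rw [he'] at hx
        exact mem_heads_waveOff_of_adj hx (hτA _ (hστ hy')) hx.2 (Or.inl rfl)
      | coe k =>
        have he' : m n y = m k y' := he
        rw [he'] at hx
        have hnk : n ≤ k := (WithTop.coe_lt_coe.1 hji).le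
        exact mem_heads_waveOff_of_adj hx (not_mem_source_of_mem_heads_waveOff hy')
          (fun h => (mem_heads_waveOff.1 hy').2 (hFmono n k hnk h)) (adj_of_del ((hm k).adj y' hy'))
  · intro i y hy
    induction i using WithTop.recTopCoe with
    | top => exact Or.inr hy
    | coe n =>
      have hx : m n y ∈ W.waveOff (F n) := (hm n).mem y hy
      by_cases hA : m n y ∈ W.A
      · exact Or.inl hA
      · exact Or.inr (mem_heads_waveOff_of_adj hx hA hx.2 (Or.inl rfl))
  · intro i y hy
    induction i using WithTop.recTopCoe with
    | top => exact Or.inl rfl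
    | coe n => exact ((hm n).grounded y hy).mono fun x hx => hx.1
  · rintro M ⟨h1, h2, h3⟩
    rw [hun'] at h1 h2 h3
    refine ⟨M, h1, ?_, h2, ?_⟩
    · intro y hy
      obtain ⟨i, hi, -, he⟩ := h3 y hy
      rw [he]
      induction i using WithTop.recTopCoe with
      | top => exact Or.inl rfl
      | coe n => exact adj_of_del ((hm n).adj y hi)
    · intro y hy
      obtain ⟨i, hi, -, he⟩ := h3 y hy
      rw [he]
      induction i using WithTop.recTopCoe with
      | top => exact Or.inr ⟨rfl, hi⟩
      | coe n => exact Or.inl (mem_waveUnion.2 ⟨F n, hFσ n, (hm n).mem y hi⟩)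

theorem exists_isMatch_of_chain {ι : Type*} [LinearOrder ι] [WellFoundedLT ι] [Nonempty ι]
    {τ : Set V} (hτA : ∀ x ∈ τ, x ∉ W.A) {S : ι → Set V} (hS : Monotone S) (hSτ : ∀ i, S i ⊆ τ)
    (hclosed : ∀ i, ∀ t ∈ S i, t ∈ W.waveUnion τ → t ∈ W.waveUnion (S i))
    (hmatch : ∀ i, ∃ m, W.IsMatch (S i) m) : ∃ m, W.IsMatch (⋃ i, S i) m := by
  choose m hm using hmatch
  have hsubU : ∀ {σ σ' : Set V}, σ ⊆ σ' → W.waveUnion σ ⊆ W.waveUnion σ' := by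
    intro σ σ' h x hx
    obtain ⟨F, hF, hx⟩ := mem_waveUnion.1 hx
    exact mem_waveUnion.2 ⟨F, hF.trans h, hx⟩
  have hun : ⋃ i, W.headUnion (S i) = W.headUnion (⋃ i, S i) := by
    refine subset_antisymm (Set.iUnion_subset fun i => headUnion_mono (Set.subset_iUnion S i)) ?_
    intro y hy
    rw [Set.mem_iUnion]
    rcases mem_headUnion.1 hy with h | ⟨F, hF, h⟩
    · obtain ⟨i, hi⟩ := Set.mem_iUnion.1 h
      exact ⟨i, Or.inl hi⟩
    · obtain ⟨i, hi⟩ := exists_subset_of_chain hS F hF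
      exact ⟨i, mem_headUnion.2 (Or.inr ⟨F, hi, h⟩)⟩
  have hnA : ∀ i, ∀ y ∈ W.headUnion (S i), y ∉ W.A := fun i y hy =>
    not_mem_source_of_mem_headUnion (fun x hx => hτA x (hSτ i hx)) hy
  refine Exists.elim (exists_glue (A := W.A) (H := fun i => W.headUnion (S i)) (m := m)
    (fun i => (hm i).inj) ?_ ?_ fun i => (hm i).grounded) ?_
  · intro i j hji y hy y' hy' he
    refine ⟨j, hji, ?_⟩
    have hadj := (hm i).adj y' hy'
    rw [← he] at hadj
    have hxj : m j y ∈ W.waveUnion (S j) → y' ∈ W.headUnion (S j) := fun h =>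
      mem_headUnion_of_adj h (hnA i y' hy') hadj
    rcases (hm j).mem y hy with h | ⟨h, hyS⟩
    · exact hxj h
    · rcases (hm i).mem y' hy' with h' | ⟨h', -⟩
      · refine hxj (hclosed j _ (h.symm ▸ hyS) ?_)
        rw [he]
        exact hsubU (hSτ i) h'
      · rw [← h', ← he, h]
        exact Or.inl hyS
  · intro i y hy
    by_cases hA : m i y ∈ W.A
    · exact Or.inl hA
    right
    rcases (hm i).mem y hy with h | ⟨h, hyS⟩
    · exact mem_headUnion_of_adj h hA (Or.inl rfl)
    · rw [h]; exact hy
  · rintro M ⟨h1, h2, h3⟩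
    rw [hun] at h1 h2 h3
    refine ⟨M, h1, ?_, h2, ?_⟩
    · intro y hy
      obtain ⟨i, hi, -, he⟩ := h3 y hy
      rw [he]
      exact (hm i).adj y hi
    · intro y hy
      obtain ⟨i, hi, -, he⟩ := h3 y hy
      rw [he]
      exact ((hm i).mem y hi).imp (fun h => hsubU (Set.subset_iUnion S i) h)
        fun h => ⟨h.1, Set.subset_iUnion S i h.2⟩

open Cardinal in
theorem exists_isMatch {τ : Set V} (hτA : ∀ x ∈ τ, x ∉ W.A)
    (hun : ∀ F : Finset V, ↑F ⊆ τ → ¬ (W.del ↑F).Hindered) : ∃ m, W.IsMatch τ m := by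
  classical
  have hc : ∀ t, ∃ F : Finset V, ↑F ⊆ τ ∧ (t ∈ W.waveUnion τ → t ∈ W.waveOff F) := by
    intro t
    by_cases ht : t ∈ W.waveUnion τ
    · obtain ⟨F, hF, h⟩ := mem_waveUnion.1 ht
      exact ⟨F, hF, fun _ => h⟩
    · exact ⟨∅, by simp, fun h => absurd h ht⟩
  choose c hcτ hc using hc
  set Φ : Finset V → Set V := fun s => ↑(s.biUnion c) with hΦ
  have hΦcard : ∀ s, #(Φ s) ≤ ℵ₀ := fun s => (Finset.countable_toSet _).le_aleph0
  have hclosed : ∀ σ : Set V, ClosedUnder Φ σ → ∀ t ∈ σ, t ∈ W.waveUnion τ →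
      t ∈ W.waveUnion σ := by
    intro σ hσ t ht htτ
    refine mem_waveUnion.2 ⟨c t, ?_, hc t htτ⟩
    simpa [hΦ] using hσ {t} (by simpa using ht)
  suffices main : ∀ μ : Cardinal.{u}, ∀ σ : Set V, #σ = μ → σ ⊆ τ → ClosedUnder Φ σ →
      ∃ m, W.IsMatch σ m by
    refine main _ τ rfl subset_rfl fun s hs x hx => ?_
    simp only [hΦ, Finset.coe_biUnion, Set.mem_iUnion] at hx
    obtain ⟨t, -, hx⟩ := hx
    exact hcτ t hx
  intro μ
  induction μ using WellFoundedLT.induction with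
  | _ μ ih =>
  intro σ hσμ hστ hσc
  rcases le_or_gt μ ℵ₀ with hμ | hμ
  · exact exists_isMatch_of_countable hτA hun hστ (le_aleph0_iff_set_countable.1 (hσμ ▸ hμ))
  obtain ⟨e⟩ : Nonempty (μ.ord.ToType ≃ σ) := Cardinal.eq.1 (by rw [mk_ord_toType, hσμ])
  have hne : Nonempty μ.ord.ToType := by
    rw [← mk_ne_zero_iff, mk_ord_toType]
    exact (aleph0_pos.trans hμ).ne'
  set S : μ.ord.ToType → Set V := fun ξ => clos Φ ((fun i => (e i : V)) '' Set.Iic ξ) with hS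
  have hSσ : ∀ ξ, S ξ ⊆ σ := fun ξ => clos_subset (by rintro _ ⟨i, -, rfl⟩; exact (e i).2) hσc
  have hU : ⋃ ξ, S ξ = σ := by
    refine subset_antisymm (Set.iUnion_subset hSσ) fun x hx => Set.mem_iUnion.2 ?_
    refine ⟨e.symm ⟨x, hx⟩, subset_clos _ _ ⟨e.symm ⟨x, hx⟩, Set.mem_Iic.2 le_rfl, by simp⟩⟩
  rw [← hU]
  refine exists_isMatch_of_chain hτA
    (fun i j hij => clos_mono (Set.image_mono (Set.Iic_subset_Iic.2 hij)))
    (fun i => (hSσ i).trans hστ) (fun i => hclosed _ (closedUnder_clos _ _)) fun i => ?_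
  refine ih _ ?_ (S i) rfl ((hSσ i).trans hστ) (closedUnder_clos _ _)
  refine (mk_clos_le (μ := max ℵ₀ #(Set.Iic i)) (le_max_left _ _)
    (mk_image_le.trans (le_max_right _ _))
    fun s => (hΦcard s).trans (le_max_left _ _)).trans_lt (max_lt hμ (mk_Iic_toType_ord_lt hμ.le i))

end Web

theorem exists_nodup_chain {r : V → V → Prop} {a b : V} (h : Relation.ReflTransGen r a b) :
    ∃ l : List V, l.Nodup ∧ l.IsChain r ∧ l.head? = some a ∧ l.getLast? = some b := by
  induction h using Relation.ReflTransGen.head_induction_on with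
  | refl => exact ⟨[b], by simp⟩
  | @head x y hxy _ ih =>
    obtain ⟨l, hl1, hl2, hl3, hl4⟩ := ih
    by_cases hx : x ∈ l
    · obtain ⟨s, t, rfl⟩ := List.append_of_mem hx
      refine ⟨x :: t, (List.nodup_append.1 hl1).2.1, (List.isChain_append.1 hl2).2.1, rfl, ?_⟩
      rw [← hl4, List.getLast?_append_of_ne_nil _ (List.cons_ne_nil x t)]
    · refine ⟨x :: l, List.nodup_cons.2 ⟨hx, hl1⟩, ?_, rfl, ?_⟩
      · rw [List.isChain_cons]
        refine ⟨fun z hz => ?_, hl2⟩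
        rw [hl3, Option.mem_some_iff] at hz
        exact hz ▸ hxy
      · rw [List.getLast?_cons, hl4]
        rfl

theorem mem_of_isChain {r : V → V → Prop} {τ : Set V} (hr : ∀ x y, r x y → y ∈ τ) {l : List V}
    {a : V} (h : l.IsChain r) (ha : l.head? = some a) {x : V} (hx : x ∈ l) : x = a ∨ x ∈ τ := by
  induction l generalizing a with
  | nil => simp at hx
  | cons b l ih =>
    rw [List.head?_cons, Option.some.injEq] at ha
    subst ha
    rcases List.mem_cons.1 hx with rfl | hx
    · exact Or.inl rfl
    rw [List.isChain_cons] at h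
    right
    cases l with
    | nil => simp at hx
    | cons c l =>
      have hc := hr _ _ (h.1 c rfl)
      rcases ih h.2 rfl hx with rfl | h
      · exact hc
      · exact h

namespace Web
variable {W : Web V}

/-- A path, given by its list of vertices, from the vertex `a` to a target. -/
structure IsLink (W : Web V) (a : V) (l : List V) : Prop where
  nodup : l.Nodup
  chain : l.IsChain W.E
  head : l.head? = some a
  last : ∃ b ∈ W.B, l.getLast? = some b

theorem IsLink.of_del {Z : Set V} {a : V} {l : List V} (h : (W.del Z).IsLink a l) : W.IsLink a l :=
  ⟨h.nodup, h.chain.imp fun _ _ h => h.1, h.head, h.last⟩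

/-- The vertices of `τ`, which avoid the sources, are reachable from `a` through `τ`, and may be
deleted finitely many at a time. -/
structure Deletable (W : Web V) (a : V) (τ : Set V) : Prop where
  not_mem : ∀ x ∈ τ, x ∉ W.A
  reach : ∀ t ∈ τ, Relation.ReflTransGen (fun x y => W.E x y ∧ y ∈ τ) a t
  unhindered : ∀ F : Finset V, ↑F ⊆ τ → ¬ ((W.del {a}).del ↑F).Hindered

theorem exists_maximal_deletable (h : ¬ W.Hindered) {a : V} (ha : a ∈ W.A) :
    ∃ τ, Maximal (W.Deletable a) τ := by
  have hempty : W.Deletable a ∅ := by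
    refine ⟨by simp, by simp, fun F hF => ?_⟩
    rw [Set.subset_empty_iff.1 hF, del_empty]
    exact not_hindered_del_source h ha
  refine Exists.imp (fun τ h => h.2) (zorn_subset_nonempty {τ | W.Deletable a τ} ?_ ∅ hempty)
  intro c hc hchain hne
  refine ⟨⋃₀ c, ⟨?_, ?_, ?_⟩, fun s hs => Set.subset_sUnion_of_mem hs⟩
  · rintro x ⟨s, hs, hx⟩
    exact (hc hs).not_mem x hx
  · rintro x ⟨s, hs, hx⟩
    exact Relation.ReflTransGen.mono (fun y z hyz => ⟨hyz.1, s, hs, hyz.2⟩) _ _ ((hc hs).reach x hx)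
  · intro F hF
    obtain ⟨s, hs, hFs⟩ := hchain.directedOn.exists_mem_subset_of_finset_subset_biUnion hne
      (f := id) (s := F) (by simpa [Set.sUnion_eq_biUnion] using hF)
    exact (hc hs).unhindered F hFs

theorem exists_safe_link (h : ¬ W.Hindered) {a : V} (ha : a ∈ W.A) :
    ∃ l, W.IsLink a l ∧ ¬ (W.del {x | x ∈ l}).Hindered := by
  classical
  obtain ⟨τ, hτ, hmax⟩ := exists_maximal_deletable h ha
  by_cases haB : a ∈ W.B
  · refine ⟨[a], ⟨by simp, by simp, rfl, a, haB, rfl⟩, ?_⟩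
    have : {x | x ∈ [a]} = ({a} : Set V) := by ext; simp
    rw [this]
    exact not_hindered_del_source h ha
  by_cases hτB : ∃ b ∈ τ, b ∈ W.B
  · obtain ⟨b, hbτ, hbB⟩ := hτB
    obtain ⟨l, h1, h2, h3, h4⟩ := exists_nodup_chain (hτ.reach b hbτ)
    refine ⟨l, ⟨h1, h2.imp fun _ _ h => h.1, h3, b, hbB, h4⟩, ?_⟩
    have hal : a ∈ l := List.mem_of_mem_head? h3
    have hun := hτ.unhindered (l.toFinset.erase a) fun x hx => by
      simp only [Finset.coe_erase, List.coe_toFinset] at hx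
      exact (mem_of_isChain (fun _ _ h => h.2) h2 h3 hx.1).resolve_left hx.2
    rw [del_del] at hun
    convert hun using 3
    ext x
    simp only [Finset.coe_erase, List.coe_toFinset, Set.singleton_union, Set.insert_sdiff_singleton]
    exact (Set.insert_eq_of_mem (s := {x | x ∈ l}) hal).symm ▸ Iff.rfl
  exfalso
  push Not at hτB
  have hτA' : ∀ x ∈ τ, x ∉ (W.del {a}).A := fun x hx h => hτ.not_mem x hx h.1
  have hext : ∀ x y, x = a ∨ x ∈ τ → W.E x y → y ∈ (W.del {a}).headUnion τ := by
    intro x y hx hxy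
    have hyA : y ∉ W.A := W.noIn x y hxy
    rw [mem_headUnion]
    by_cases hyτ : y ∈ τ
    · exact Or.inl hyτ
    right
    by_contra! hno
    refine hyτ (hmax (y := insert y τ) ⟨?_, ?_, ?_⟩ (Set.subset_insert y τ) (Set.mem_insert y τ))
    · rintro z (rfl | hz)
      · exact hyA
      · exact hτ.not_mem z hz
    · have hmono : ∀ t, Relation.ReflTransGen (fun x y => W.E x y ∧ y ∈ τ) a t →
          Relation.ReflTransGen (fun x z => W.E x z ∧ z ∈ insert y τ) a t :=
        fun t ht => Relation.ReflTransGen.mono (fun _ _ h => ⟨h.1, Or.inr h.2⟩) _ _ ht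
      rintro z (rfl | hz)
      · refine Relation.ReflTransGen.tail (b := x) ?_ ⟨hxy, Or.inl rfl⟩
        rcases hx with rfl | hx
        · exact .refl
        · exact hmono _ (hτ.reach x hx)
      · exact hmono _ (hτ.reach z hz)
    · intro F hF hh
      have hF0 : ((F.erase y : Finset V) : Set V) ⊆ τ := by
        intro z hz
        rw [Finset.coe_erase] at hz
        exact (hF hz.1).resolve_left hz.2
      by_cases hyF : y ∈ F
      · refine hno _ hF0 (mem_heads_waveOff.2 ⟨?_, by simp⟩)
        refine hit_of_hindered_del (hτ.unhindered _ hF0) (fun h => hyA h.1.1) ?_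
        rw [del_del _ _ {y}]
        convert hh using 2
        ext z
        simp only [Finset.coe_erase, Set.union_singleton, Set.insert_sdiff_singleton]
        rw [Set.insert_eq_of_mem (show y ∈ (F : Set V) from hyF)]
      · rw [Finset.erase_eq_of_notMem hyF] at hF0
        exact hτ.unhindered F hF0 hh
  obtain ⟨m, hm⟩ := exists_isMatch hτA' hτ.unhindered
  set I : Set V := insert a τ ∪ (W.del {a}).waveUnion τ with hI
  have hsub : W.heads I ⊆ (W.del {a}).headUnion τ := by
    rintro y ⟨hyA, x, hx, hxy⟩
    have hya : y ≠ a := fun h => hyA (h ▸ ha)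
    by_cases hxa : x = a ∨ x ∈ τ
    · rcases hxy with rfl | hxy
      · exact Or.inl (hxa.resolve_left hya)
      · exact hext x y hxa hxy
    · rcases hx with hx | hx
      · exact absurd hx hxa
      · exact mem_headUnion_of_adj hx (fun h => hyA h.1)
          (adj_del hxy (fun h => hxa (Or.inl h)) hya)
  refine h ⟨I, m, a, ⟨?_, ?_, ?_, hm.inj.mono hsub, ?_⟩, Or.inl (Or.inl rfl), ?_⟩
  · rintro x ((rfl | hx) | hx)
    · exact haB
    · exact hτB x hx
    · obtain ⟨F, -, hx⟩ := mem_waveUnion.1 hx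
      obtain ⟨m', hm'⟩ := (W.del {a}).exists_isWave_waveOff F
      exact hm'.avoid x hx
  · intro y hy
    rcases hm.mem y (hsub hy) with h | ⟨h, hyτ⟩
    · exact Or.inr h
    · rw [h]; exact Or.inl (Or.inr hyτ)
  · exact fun y hy => adj_of_del (hm.adj y (hsub hy))
  · exact fun y hy => (hm.grounded y (hsub hy)).mono fun x hx => hx.1
  · rintro ⟨y, hy, hya⟩
    rcases hm.adj y (hsub hy) with h | h
    · exact hy.1 (h ▸ hya ▸ ha)
    · exact h.2.1 hya

end Web

theorem Grounded.of_eqOn {T G : Set V} {m m' : V → V} (heq : ∀ y ∈ G, m' y = m y)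
    (hstep : ∀ y ∈ G, m y ∈ T ∪ G) {y : V} (hy : y ∈ G) (h : Grounded T m y) :
    Grounded T m' y := by
  rcases h with h | ⟨n, hn⟩
  · exact Or.inl ((heq y hy).trans h)
  right
  induction n generalizing y with
  | zero => exact ⟨0, hn⟩
  | succ n ih =>
    rcases hstep y hy with h | h
    · exact ⟨1, by rwa [Function.iterate_one, heq y hy]⟩
    · rw [Function.iterate_succ_apply] at hn
      obtain ⟨k, hk⟩ := ih h hn
      exact ⟨k + 1, by rwa [Function.iterate_succ_apply, heq y hy]⟩

namespace Web
variable {W : Web V}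

/-- Hindrances of a well-ordered family of subwebs, each leaving a spare vertex `p j` that is
assigned to some vertex deleted at an earlier stage, combine to a hindrance. -/
theorem hindered_of_stages {ι : Type*} [LinearOrder ι] [WellFoundedLT ι] [Nonempty ι]
    {Z I : ι → Set V} {m : ι → V → V} {p : ι → V} {des : ι → Option V}
    (hw : ∀ j, (W.del (Z j)).IsWave (I j) (m j)) (hd : ∀ j, Disjoint (I j) (Z j))
    (hp : ∀ j, p j ∈ I j) (hpm : ∀ j, p j ∉ m j '' (W.del (Z j)).heads (I j))
    (hmono : ∀ i j, i < j → Z i ⊆ Z j) (hpZ : ∀ i j, i < j → p i ∈ Z j)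
    (hcl : ∀ i j, i < j → ∀ x ∈ (W.del (Z i)).heads (I i), x ∈ Z j ↔ m i x ∈ Z j)
    (hdes : ∀ i y, y ∈ Z i → y ∉ W.A → (∃ x ∈ I i, W.E x y) →
      ∃ j, i < j ∧ des j = some y ∧ W.E (p j) y) : W.Hindered := by
  classical
  set H : ι → Set V := fun j => (W.del (Z j)).heads (I j) with hH
  have hHiff : ∀ j y, y ∈ H j ↔ y ∈ W.heads (I j) ∧ y ∉ Z j := fun j y => by
    rw [hH]; simp only [heads_del (hd j)]; rfl
  have hHA : ∀ j y, y ∈ H j → y ∉ W.A := fun j y h => ((hHiff j y).1 h).1.1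
  have hmI : ∀ j y, y ∈ H j → m j y ∈ I j := fun j y h => (hw j).mem y h
  have hIZ : ∀ j x, x ∈ I j → x ∉ Z j := fun j x h h' => Set.disjoint_left.1 (hd j) h h'
  have hadj : ∀ j y, y ∈ H j → W.adj (m j y) y := fun j y h => adj_of_del ((hw j).adj y h)
  have hmono' : ∀ i j, i ≤ j → Z i ⊆ Z j := fun i j h =>
    h.eq_or_lt.elim (fun h => h ▸ subset_rfl) (hmono i j)
  have hmem : ∀ j y, y ∈ H j → m j y ∈ W.A ∪ H j := by
    intro j y hy
    by_cases hA : m j y ∈ W.A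
    · exact Or.inl hA
    · exact Or.inr ((hHiff j _).2 ⟨mem_heads_self (hmI j y hy) hA, hIZ j _ (hmI j y hy)⟩)
  -- two vertices are in the same layer when they belong to the same sets `Z k`
  set sim : V → V → Prop := fun x y => ∀ k, x ∈ Z k ↔ y ∈ Z k with hsim
  have hsymm : ∀ {x y}, sim x y → sim y x := fun h k => (h k).symm
  have htrans : ∀ {x y z}, sim x y → sim y z → sim x z := fun h h' k => (h k).trans (h' k)
  have hmsim : ∀ j y, y ∈ H j → sim (m j y) y := by
    intro j y hy k
    rcases le_or_gt k j with hk | hk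
    · refine iff_of_false (fun h => hIZ j _ (hmI j y hy) (hmono' k j hk h)) fun h => ?_
      exact ((hHiff j y).1 hy).2 (hmono' k j hk h)
    · exact (hcl j k hk y hy).symm
  have hpsim : ∀ i j, sim (p i) (p j) → i = j := by
    intro i j h
    rcases lt_trichotomy i j with hij | hij | hij
    · exact absurd ((h j).1 (hpZ i j hij)) (hIZ j _ (hp j))
    · exact hij
    · exact absurd ((h i).2 (hpZ j i hij)) (hIZ i _ (hp i))
  have hinH : ∀ j x y, x ∈ I j → W.adj x y → y ∉ W.A → sim y (p j) → y ∈ H j := by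
    intro j x y hx hxy hyA hy
    exact (hHiff j y).2 ⟨⟨hyA, x, hx, hxy⟩, fun h => hIZ j _ (hp j) ((hy j).1 h)⟩
  set Hb : Set V := {y | ∃ j, y ∈ H j ∧ sim y (p j)} with hHb
  have hst : ∀ y, ∃ j, y ∈ Hb → y ∈ H j ∧ sim y (p j) := by
    intro y
    by_cases hy : y ∈ Hb
    · obtain ⟨j, hj⟩ := hy
      exact ⟨j, fun _ => hj⟩
    · exact ⟨Classical.arbitrary ι, fun h => absurd h hy⟩
  choose st hst using hst
  set mb : V → V := fun y => m (st y) y with hmb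
  have hmb' : ∀ j y, y ∈ H j → sim y (p j) → mb y = m j y := by
    intro j y hy hs
    have : st y = j := hpsim _ _ (htrans (hsymm (hst y ⟨j, hy, hs⟩).2) hs)
    simp only [hmb, this]
  have hmemb : ∀ j y, y ∈ H j → sim y (p j) → m j y ∈ W.A ∪ {y | y ∈ H j ∧ sim y (p j)} := by
    intro j y hy hs
    exact (hmem j y hy).imp_right fun h => ⟨h, htrans (hmsim j y hy) hs⟩
  set HH : WithBot ι → Set V := fun i => i.recBotCoe Hb H with hHH
  set mm : WithBot ι → V → V := fun i => i.recBotCoe mb m with hmm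
  have hun : ⋃ i, HH i = ⋃ j, H j := by
    refine subset_antisymm (Set.iUnion_subset fun i => ?_) (Set.iUnion_subset fun j => ?_)
    · induction i using WithBot.recBotCoe with
      | bot => rintro y ⟨j, hj, -⟩; exact Set.mem_iUnion.2 ⟨j, hj⟩
      | coe j => exact Set.subset_iUnion H j
    · exact Set.subset_iUnion HH (j : WithBot ι)
  obtain ⟨M, hMinj, hMg, hM⟩ : ∃ M : V → V, Set.InjOn M (⋃ i, HH i) ∧
      (∀ y ∈ ⋃ i, HH i, Grounded W.A M y) ∧
      ∀ y ∈ ⋃ i, HH i, ∃ i, y ∈ HH i ∧ (∀ k < i, y ∉ HH k) ∧ M y = mm i y := by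
    refine exists_glue ?_ ?_ ?_ ?_
    · intro i
      induction i using WithBot.recBotCoe with
      | bot =>
        rintro y ⟨j, hy, hys⟩ y' ⟨j', hy', hys'⟩ he
        have he' : m j y = m j' y' := by
          rw [← hmb' j y hy hys, ← hmb' j' y' hy' hys']; exact he
        have hjj : j = j' := by
          refine hpsim _ _ (htrans (hsymm (htrans (hmsim j y hy) hys)) ?_)
          rw [he']
          exact htrans (hmsim j' y' hy') hys'
        subst hjj
        exact (hw j).inj hy hy' he'
      | coe j => exact (hw j).inj
    · intro i j hji y hy y' hy' he
      refine ⟨j, hji, ?_⟩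
      induction i using WithBot.recBotCoe with
      | bot => exact absurd hji not_lt_bot
      | coe i =>
        induction j using WithBot.recBotCoe with
        | bot =>
          obtain ⟨j, hy, hys⟩ := hy
          have he' : m j y = m i y' := by rw [← hmb' j y hy hys]; exact he
          have hs : sim y' (p j) := by
            refine htrans (hsymm (hmsim i y' hy')) ?_
            rw [← he']
            exact htrans (hmsim j y hy) hys
          refine ⟨j, hinH j _ y' (hmI j y hy) ?_ (hHA i y' hy') hs, hs⟩
          rw [he']
          exact hadj i y' hy'
        | coe j =>
          have he' : m j y = m i y' := he
          have hji' : j < i := WithBot.coe_lt_coe.1 hji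
          refine (hHiff j y').2 ⟨⟨hHA i y' hy', m j y, hmI j y hy, ?_⟩, fun h => ?_⟩
          · rw [he']; exact hadj i y' hy'
          · exact ((hHiff i y').1 hy').2 (hmono j i hji' h)
    · intro i y hy
      induction i using WithBot.recBotCoe with
      | bot =>
        obtain ⟨j, hy, hys⟩ := hy
        have : mm ⊥ y = m j y := hmb' j y hy hys
        rw [this]
        exact (hmemb j y hy hys).imp_right fun h => ⟨j, h⟩
      | coe j => exact hmem j y hy
    · intro i y hy
      have hg : ∀ j y, y ∈ H j → Grounded W.A (m j) y := fun j y hy =>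
        ((hw j).grounded y hy).mono fun x hx => hx.1
      induction i using WithBot.recBotCoe with
      | bot =>
        obtain ⟨j, hy, hys⟩ := hy
        exact (hg j y hy).of_eqOn (G := {y | y ∈ H j ∧ sim y (p j)})
          (fun z hz => hmb' j z hz.1 hz.2) (fun z hz => hmemb j z hz.1 hz.2) ⟨hy, hys⟩
      | coe j => exact hg j y hy
  rw [hun] at hMinj hMg hM
  -- on its own stage each value is the value of a stage matching
  have hMst : ∀ y ∈ ⋃ j, H j, ∃ j, y ∈ H j ∧ M y = m j y := by
    intro y hy
    obtain ⟨i, hi, -, he⟩ := hM y hy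
    induction i using WithBot.recBotCoe with
    | bot =>
      obtain ⟨j, hj, hs⟩ := hi
      exact ⟨j, hj, he.trans (hmb' j y hj hs)⟩
    | coe j => exact ⟨j, hi, he⟩
  have hMp : ∀ j, p j ∉ M '' ⋃ j, H j := by
    rintro j ⟨y, hy, hyj⟩
    obtain ⟨i, hi, hmin, he⟩ := hM y hy
    rw [hyj] at he
    induction i using WithBot.recBotCoe with
    | bot =>
      obtain ⟨k, hk, hs⟩ := hi
      have he' : p j = m k y := he.trans (hmb' k y hk hs)
      have : j = k := hpsim _ _ (he' ▸ htrans (hmsim k y hk) hs)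
      subst this
      exact hpm j ⟨y, hk, he'.symm⟩
    | coe i =>
      have he' : p j = m i y := he
      have hs : sim y (p j) := he' ▸ hsymm (hmsim i y hi)
      exact hmin ⊥ (WithBot.bot_lt_coe i)
        ⟨j, hinH j _ y (hp j) (he' ▸ hadj i y hi) (hHA i y hi) hs, hs⟩
  have hT : ∀ y ∈ W.heads (⋃ j, I j), y ∉ (⋃ j, H j) →
      ∃ i j, i < j ∧ des j = some y ∧ W.E (p j) y := by
    intro y hy hyH
    rw [heads_iUnion] at hy
    obtain ⟨j, hj⟩ := Set.mem_iUnion.1 hy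
    have hyZ : y ∈ Z j := by
      by_contra h
      exact hyH (Set.mem_iUnion.2 ⟨j, (hHiff j y).2 ⟨hj, h⟩⟩)
    obtain ⟨hyA, x, hx, hxy⟩ := hj
    refine ⟨j, hdes j y hyZ hyA ⟨x, hx, hxy.resolve_left ?_⟩⟩
    rintro rfl
    exact hIZ j x hx hyZ
  choose! lo J hlo hJdes hJE using hT
  set U : Set V := ⋃ j, H j with hU
  set M' : V → V := fun y => if y ∈ U then M y else p (J y) with hM'
  have hM1 : ∀ y ∈ U, M' y = M y := fun y hy => if_pos hy
  have hM2 : ∀ y, y ∉ U → M' y = p (J y) := fun y hy => if_neg hy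
  have hpinj : Function.Injective p := fun i j h => hpsim i j (h ▸ fun _ => Iff.rfl)
  have hIU : ∀ j, ∀ x ∈ I j, x ∈ W.A ∪ U := by
    intro j x hx
    by_cases hA : x ∈ W.A
    · exact Or.inl hA
    · exact Or.inr (Set.mem_iUnion.2 ⟨j, (hHiff j _).2 ⟨mem_heads_self hx hA, hIZ j _ hx⟩⟩)
  have hMinj' : Set.InjOn M' (W.heads (⋃ j, I j)) := by
    intro y hy z hz h
    by_cases hyU : y ∈ U <;> by_cases hzU : z ∈ U
    · rw [hM1 y hyU, hM1 z hzU] at h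
      exact hMinj hyU hzU h
    · rw [hM1 y hyU, hM2 z hzU] at h
      exact absurd ⟨y, hyU, h⟩ (hMp _)
    · rw [hM2 y hyU, hM1 z hzU] at h
      exact absurd ⟨z, hzU, h.symm⟩ (hMp _)
    · rw [hM2 y hyU, hM2 z hzU] at h
      have h1 := hJdes y hy hyU
      rw [hpinj h, hJdes z hz hzU, Option.some.injEq] at h1
      exact h1.symm
  have hgU : ∀ y ∈ U, Grounded W.A M' y := fun y hy =>
    (hMg y hy).of_eqOn hM1 (fun z hz => by
      obtain ⟨j, hj, he⟩ := hMst z hz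
      rw [he]
      exact hIU j _ (hmI j z hj)) hy
  obtain ⟨j0, hj0⟩ : ∃ j0 : ι, ∀ j, j0 ≤ j := by
    obtain ⟨j0, -, h⟩ := wellFounded_lt.has_min (Set.univ : Set ι) Set.univ_nonempty
    exact ⟨j0, fun j => not_lt.1 (h j trivial)⟩
  refine ⟨⋃ j, I j, M', p j0, ⟨?_, ?_, ?_, hMinj', ?_⟩, Set.mem_iUnion.2 ⟨j0, hp j0⟩, ?_⟩
  · intro x hx
    obtain ⟨j, hj⟩ := Set.mem_iUnion.1 hx
    exact (hw j).avoid x hj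
  · intro y hy
    by_cases hyU : y ∈ U
    · obtain ⟨j, hj, he⟩ := hMst y hyU
      rw [hM1 y hyU, he]
      exact Set.mem_iUnion.2 ⟨j, hmI j y hj⟩
    · rw [hM2 y hyU]
      exact Set.mem_iUnion.2 ⟨_, hp _⟩
  · intro y hy
    by_cases hyU : y ∈ U
    · obtain ⟨j, hj, he⟩ := hMst y hyU
      rw [hM1 y hyU, he]
      exact hadj j y hj
    · rw [hM2 y hyU]
      exact Or.inr (hJE y hy hyU)
  · intro y hy
    by_cases hyU : y ∈ U
    · exact hgU y hyU
    · rcases hIU _ _ (hp (J y)) with h | h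
      · exact Or.inr ⟨1, by rwa [Function.iterate_one, hM2 y hyU]⟩
      · rcases hgU _ h with h' | ⟨k, hk⟩
        · exfalso
          have hpH : p (J y) ∈ W.heads (⋃ j, I j) := by
            refine mem_heads_self (Set.mem_iUnion.2 ⟨_, hp _⟩) ?_
            obtain ⟨j, hj⟩ := Set.mem_iUnion.1 h
            exact hHA j _ hj
          refine hyU ?_
          rw [hMinj' hy hpH ((hM2 y hyU).trans h'.symm)]
          exact h
        · exact Or.inr ⟨k + 1, by rwa [Function.iterate_succ_apply, hM2 y hyU]⟩
  · rintro ⟨y, hy, he⟩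
    by_cases hyU : y ∈ U
    · exact hMp j0 ⟨y, hyU, (hM1 y hyU).symm.trans he⟩
    · rw [hM2 y hyU] at he
      have := hlo y hy hyU
      rw [hpinj he] at this
      exact absurd this (not_lt.2 (hj0 _))

end Web

open Cardinal in
theorem mk_lt_of_finite {κ : Cardinal.{u}} (hκ : ℵ₀ ≤ κ) {s : Set V} (hs : s.Finite) : #s < κ :=
  (lt_aleph0_iff_set_finite.2 hs).trans_le hκ

open Cardinal in
theorem mk_union_lt_of_lt {κ : Cardinal.{u}} (hκ : ℵ₀ ≤ κ) {s t : Set V} (hs : #s < κ)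
    (ht : #t < κ) : #(s ∪ t : Set V) < κ :=
  (mk_union_le s t).trans_lt (add_lt_of_lt hκ hs ht)

theorem exists_wf_rec {ι σ : Type*} [LinearOrder ι] [WellFoundedLT ι]
    (P : ∀ j : ι, (∀ i, i < j → σ) → σ → Prop) (hP : ∀ j g, ∃ t, P j g t) :
    ∃ f : ι → σ, ∀ j, P j (fun i _ => f i) (f j) := by
  choose F hF using hP
  refine ⟨WellFounded.fix (wellFounded_lt (α := ι)) (fun j g => F j g), fun j => ?_⟩
  conv in (occs := 2) WellFounded.fix _ _ _ => rw [WellFounded.fix_eq]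
  exact hF j _

open Cardinal in
theorem exists_option_enum {ι : Type u} {T : Set V} (h : #T ≤ #ι) :
    ∃ e : ι → Option V, (∀ y ∈ T, ∃ ξ, e ξ = some y) ∧ ∀ ξ y, e ξ = some y → y ∈ T := by
  classical
  obtain ⟨φ⟩ := h
  refine ⟨fun ξ => (Function.partialInv φ ξ).map Subtype.val, fun y hy => ⟨φ ⟨y, hy⟩, ?_⟩, ?_⟩
  · simp [Function.partialInv_left φ.injective]
  · intro ξ y hy
    obtain ⟨z, -, rfl⟩ := Option.map_eq_some_iff.1 hy
    exact z.2

open Cardinal in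
theorem exists_bookkeeping {κ : Cardinal.{u}} (hκ : ℵ₀ ≤ κ) :
    ∃ b : κ.ord.ToType → κ.ord.ToType × κ.ord.ToType, ∀ p, ∃ j, p.1 < j ∧ b j = p := by
  have hc : #(κ.ord.ToType) = #(κ.ord.ToType × κ.ord.ToType × κ.ord.ToType) := by
    simp [mul_eq_self hκ]
  obtain ⟨e⟩ := Cardinal.eq.1 hc
  refine ⟨fun j => ((e j).1, (e j).2.1), fun p => ?_⟩
  by_contra! hcon
  have hsub : Set.range (fun η => e.symm (p.1, p.2, η)) ⊆ Set.Iic p.1 := by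
    rintro _ ⟨η, rfl⟩
    by_contra hlt
    exact hcon _ (not_le.1 hlt) (by simp)
  have h1 := mk_le_mk_of_subset hsub
  rw [mk_range_eq _ (fun a b h => by simpa using h), mk_ord_toType] at h1
  exact absurd (mk_Iic_toType_ord_lt hκ p.1) (not_lt.2 h1)

namespace Web
variable {W : Web V}

open Cardinal in
/-- In an unhindered web, deleting any of club many small sets leaves the web unhindered. -/
theorem exists_club {κ : Cardinal.{u}} (hreg : κ.IsRegular) (h : ¬ W.Hindered) :
    ∃ Φ : Finset V → Set V, (∀ s, #(Φ s) < κ) ∧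
      ∀ Z : Set V, #Z < κ → ClosedUnder Φ Z → ¬ (W.del Z).Hindered := by
  classical
  by_contra! hcon
  have hκ : ℵ₀ ≤ κ := hreg.aleph0_le
  have hex : ∀ Z : Set V, ∃ I, (W.del Z).Hindered → (W.del Z).Critical I := fun Z => by
    by_cases hZ : (W.del Z).Hindered
    · obtain ⟨I, hI⟩ := hZ.exists_critical
      exact ⟨I, fun _ => hI⟩
    · exact ⟨∅, fun h => absurd h hZ⟩
  choose I hI using hex
  set att : Set V → Set V := fun Z => {y | y ∈ Z ∧ y ∉ W.A ∧ ∃ x ∈ I Z, W.E x y} with hatt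
  -- vertices attached to club-often many of the hindered sets
  set Pop : V → Prop := fun y => ∀ Φ : Finset V → Set V, (∀ s, #(Φ s) < κ) →
    ∃ Z : Set V, #Z < κ ∧ ClosedUnder Φ Z ∧ (W.del Z).Hindered ∧ y ∈ att Z with hPop
  have hΦ0 : ∀ y, ∃ Φ : Finset V → Set V, (∀ s, #(Φ s) < κ) ∧ (¬ Pop y →
      ∀ Z : Set V, #Z < κ → ClosedUnder Φ Z → (W.del Z).Hindered → y ∉ att Z) := by
    intro y
    by_cases hy : Pop y
    · exact ⟨fun _ => ∅, fun s => mk_lt_of_finite hκ Set.finite_empty, fun h => absurd hy h⟩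
    · rw [hPop] at hy
      push Not at hy
      obtain ⟨Φ, h1, h2⟩ := hy
      exact ⟨Φ, h1, fun _ => h2⟩
  choose Φ0 hΦ0c hΦ0 using hΦ0
  set Φ1 : Finset V → Set V := fun s => ⋃ q : {q : V × Finset V // q.1 ∈ s ∧ q.2 ⊆ s},
    Φ0 q.1.1 q.1.2 with hΦ1
  have hfinq : ∀ s : Finset V, Finite {q : V × Finset V // q.1 ∈ s ∧ q.2 ⊆ s} := fun s =>
    ((s ×ˢ s.powerset).finite_toSet.subset fun q hq => Finset.mem_coe.2
      (Finset.mem_product.2 ⟨hq.1, Finset.mem_powerset.2 hq.2⟩))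
  have hΦ1c : ∀ s, #(Φ1 s) < κ := fun s => by
    have := hfinq s
    refine (card_iUnion_lt_iff_forall_of_isRegular hreg ?_).2 fun q => hΦ0c _ _
    exact (lt_aleph0_of_finite _).trans_le hκ
  have hpop : ∀ Z : Set V, #Z < κ → ClosedUnder Φ1 Z → (W.del Z).Hindered → ∀ y ∈ att Z, Pop y := by
    intro Z hZ hcl hh y hy
    by_contra hnp
    refine hΦ0 y hnp Z hZ (fun t ht => ?_) hh hy
    have hsub : (↑(insert y t) : Set V) ⊆ Z := by
      rw [Finset.coe_insert]
      exact Set.insert_subset hy.1 ht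
    refine subset_trans ?_ (hcl _ hsub)
    exact Set.subset_iUnion_of_subset ⟨(y, t), by simp, by simp⟩ subset_rfl
  obtain ⟨b, hb⟩ := exists_bookkeeping hκ
  have he : ∀ Z : Set V, ∃ e : κ.ord.ToType → Option V, #Z < κ →
      (∀ y ∈ att Z, ∃ ξ, e ξ = some y) ∧ ∀ ξ y, e ξ = some y → y ∈ att Z := by
    intro Z
    by_cases hZ : #Z < κ
    · have : #(att Z) ≤ #(κ.ord.ToType) := by
        rw [mk_ord_toType]
        exact (mk_le_mk_of_subset fun y hy => hy.1).trans hZ.le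
      obtain ⟨e, he⟩ := exists_option_enum this
      exact ⟨e, fun _ => he⟩
    · exact ⟨fun _ => none, fun h => absurd h hZ⟩
  choose e he using he
  set Good : Set V × (V → V) × V → Prop := fun t => #t.1 < κ ∧ Disjoint (I t.1) t.1 ∧
    (W.del t.1).IsWave (I t.1) t.2.1 ∧ t.2.2 ∈ I t.1 ∧
    t.2.2 ∉ t.2.1 '' (W.del t.1).heads (I t.1) ∧ ∀ y ∈ att t.1, Pop y with hGood
  set Ψ : ∀ j : κ.ord.ToType, (∀ i, i < j → {t // Good t}) → Finset V → Set V := fun j g s =>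
    Φ1 s ∪ ⋃ i : Set.Iio j, ((g i i.2).1.1 ∪ {(g i i.2).1.2.2}) ∪
      ((g i i.2).1.2.1 '' ↑s ∪
        {x | x ∈ (W.del (g i i.2).1.1).heads (I (g i i.2).1.1) ∧ (g i i.2).1.2.1 x ∈ s}) with hΨ
  have hΨc : ∀ j g s, #(Ψ j g s) < κ := by
    intro j g s
    refine mk_union_lt_of_lt hκ (hΦ1c s) ?_
    refine (card_iUnion_lt_iff_forall_of_isRegular hreg ?_).2 fun i => ?_
    · exact mk_Iio_ord_lt j
    refine mk_union_lt_of_lt hκ (mk_union_lt_of_lt hκ (g i i.2).2.1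
      (mk_lt_of_finite hκ (Set.finite_singleton _))) ?_
    refine mk_union_lt_of_lt hκ (mk_lt_of_finite hκ (s.finite_toSet.image _))
      (mk_lt_of_finite hκ ?_)
    refine Set.Finite.of_finite_image (f := (g i i.2).1.2.1)
      (s.finite_toSet.subset ?_) ((g i i.2).2.2.2.1.inj.mono fun x hx => hx.1)
    rintro _ ⟨x, hx, rfl⟩
    exact hx.2
  refine Exists.elim (exists_wf_rec (ι := κ.ord.ToType) (σ := {t // Good t})
    (fun j g t => ClosedUnder (Ψ j g) t.1.1 ∧ ∀ hlt : (b j).1 < j, ∀ y,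
      e (g (b j).1 hlt).1.1 (b j).2 = some y → W.E t.1.2.2 y) ?_) ?_
  · intro j g
    have key : ∀ Z : Set V, #Z < κ → ClosedUnder (Ψ j g) Z → (W.del Z).Hindered → ∀ x ∈ I Z,
        ∃ m, Good (Z, m, x) := by
      intro Z hZ hcl hh x hx
      obtain ⟨m, hm, hxm⟩ := (hI Z hh).2 x hx
      refine ⟨m, hZ, (hI Z hh).disjoint, hm, hx, hxm, hpop Z hZ (fun s hs => ?_) hh⟩
      exact Set.subset_union_left.trans (hcl s hs)
    by_cases hj : ∃ hlt : (b j).1 < j, ∃ y, e (g (b j).1 hlt).1.1 (b j).2 = some y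
    · obtain ⟨hlt, y, hy⟩ := hj
      have hg := (g (b j).1 hlt).2
      obtain ⟨Z, hZ, hcl, hh, -, -, x, hx, hxy⟩ :=
        hg.2.2.2.2.2 y ((he _ hg.1).2 _ y hy) (Ψ j g) (hΨc j g)
      obtain ⟨m, hm⟩ := key Z hZ hcl hh x hx
      refine ⟨⟨(Z, m, x), hm⟩, hcl, fun _ y' hy' => ?_⟩
      rw [hy, Option.some.injEq] at hy'
      exact hy' ▸ hxy
    · obtain ⟨Z, hZ, hcl, hh⟩ := hcon (Ψ j g) (hΨc j g)
      obtain ⟨x, hx⟩ := (hI Z hh).1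
      obtain ⟨m, hm⟩ := key Z hZ hcl hh x hx
      exact ⟨⟨(Z, m, x), hm⟩, hcl, fun hlt y hy => absurd ⟨hlt, y, hy⟩ hj⟩
  rintro f hf
  have hne : Nonempty κ.ord.ToType := by
    rw [← mk_ne_zero_iff, mk_ord_toType]
    exact (aleph0_pos.trans_le hκ).ne'
  have hsub : ∀ i j, i < j → ∀ s : Finset V, (s : Set V) ⊆ (f j).1.1 →
      (((f i).1.1 ∪ {(f i).1.2.2}) ∪ ((f i).1.2.1 '' ↑s ∪
        {x | x ∈ (W.del (f i).1.1).heads (I (f i).1.1) ∧ (f i).1.2.1 x ∈ s})) ⊆ (f j).1.1 := by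
    intro i j hij s hs
    refine subset_trans ?_ ((hf j).1 s hs)
    exact fun x hx => Or.inr (Set.mem_iUnion.2 ⟨⟨i, hij⟩, hx⟩)
  refine h (hindered_of_stages (Z := fun j => (f j).1.1) (I := fun j => I (f j).1.1)
    (m := fun j => (f j).1.2.1) (p := fun j => (f j).1.2.2)
    (des := fun j => e (f (b j).1).1.1 (b j).2) (fun j => (f j).2.2.2.1) (fun j => (f j).2.2.1)
    (fun j => (f j).2.2.2.2.1) (fun j => (f j).2.2.2.2.2.1) ?_ ?_ ?_ ?_)
  · exact fun i j hij => fun x hx => hsub i j hij ∅ (by simp) (Or.inl (Or.inl hx))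
  · exact fun i j hij => hsub i j hij ∅ (by simp) (Or.inl (Or.inr rfl))
  · intro i j hij x hx
    constructor
    · intro hxj
      refine hsub i j hij {x} (by simpa using hxj) (Or.inr (Or.inl ?_))
      exact Set.mem_image_of_mem _ (by simp)
    · intro hxj
      exact hsub i j hij {(f i).1.2.1 x} (by simpa using hxj) (Or.inr (Or.inr ⟨hx, by simp⟩))
  · intro i y hy hyA hx
    obtain ⟨ξ, hξ⟩ := (he _ (f i).2.1).1 y ⟨hy, hyA, hx⟩
    obtain ⟨j, hij, hbj⟩ := hb (i, ξ)
    have hd : e (f (b j).1).1.1 (b j).2 = some y := by rw [hbj]; exact hξ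
    exact ⟨j, hij, hd, (hf j).2 (by rw [hbj]; exact hij) y hd⟩

end Web

open Cardinal in
theorem exists_finite_cover {ι : Type u} {T : Set V} {Ξ : Set ι} (h : #T ≤ #Ξ) :
    ∃ e : ι → Set V, (∀ ξ, (e ξ).Finite) ∧ ∀ y ∈ T, ∃ ξ ∈ Ξ, y ∈ e ξ := by
  obtain ⟨φ⟩ := h
  refine ⟨fun ξ => {y | ∃ h : y ∈ T, (φ ⟨y, h⟩ : ι) = ξ}, fun ξ => Set.Subsingleton.finite ?_,
    fun y hy => ⟨φ ⟨y, hy⟩, (φ ⟨y, hy⟩).2, hy, rfl⟩⟩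
  rintro x ⟨hx, rfl⟩ y ⟨hy, h⟩
  simpa using (φ.injective (Subtype.val_injective h)).symm

theorem exists_chain {ι : Type*} [LinearOrder ι] [WellFoundedLT ι] (Q : ι → Set V → Set V → Prop)
    (h : ∀ j (f : ι → Set V), (∀ i < j, Q i (⋃ k < i, f k) (f i)) → ∃ M, Q j (⋃ k < j, f k) M) :
    ∃ f : ι → Set V, ∀ j, Q j (⋃ k < j, f k) (f j) := by
  classical
  refine Exists.elim (exists_wf_rec (σ := Set V) (fun j g t =>
    (∀ i < j, Q i (⋃ k < i, if h : k < j then g k h else ∅) (if h : i < j then g i h else ∅)) →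
      Q j (⋃ k < j, if h : k < j then g k h else ∅) t) ?_) ?_
  · intro j g
    by_cases hj : ∀ i < j, Q i (⋃ k < i, if h : k < j then g k h else ∅)
        (if h : i < j then g i h else ∅)
    · obtain ⟨M, hM⟩ := h j _ hj
      exact ⟨M, fun _ => hM⟩
    · exact ⟨∅, fun h => absurd h hj⟩
  intro f hf
  have hU : ∀ i j, i ≤ j → (⋃ k < i, if _ : k < j then f k else ∅) = ⋃ k < i, f k := by
    intro i j hij
    refine Set.iUnion_congr fun k => Set.iUnion_congr fun hk => ?_
    rw [dif_pos (hk.trans_le hij)]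
  refine ⟨f, fun j => ?_⟩
  induction j using WellFoundedLT.induction with
  | _ j ih =>
    have := hf j
    rw [hU j j le_rfl] at this
    refine this fun i hi => ?_
    rw [hU i j hi.le, dif_pos hi]
    exact ih i hi

theorem biUnion_lt_succ {f : ℕ → Set V} {n : ℕ} (hf : (⋃ k < n, f k) ⊆ f n) :
    ⋃ k < n + 1, f k = f n := by
  refine subset_antisymm (Set.iUnion₂_subset fun k hk => ?_) fun x hx =>
    Set.mem_iUnion₂.2 ⟨n, n.lt_succ_self, hx⟩
  rcases (Nat.lt_succ_iff.1 hk).eq_or_lt with rfl | h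
  · exact subset_rfl
  · exact (Set.subset_iUnion₂ (s := fun k (_ : k < n) => f k) k h).trans hf

theorem monotone_of_biUnion_subset {ι : Type*} [LinearOrder ι] {f : ι → Set V}
    (hf : ∀ i, (⋃ k < i, f k) ⊆ f i) : Monotone f := fun i j hij =>
  hij.eq_or_lt.elim (fun h => h ▸ subset_rfl) fun h _ hx => hf j (Set.mem_iUnion₂.2 ⟨i, h, hx⟩)

namespace Web
variable {W : Web V}

theorem IsLink.mem_cases {a x : V} {l : List V} (h : W.IsLink a l) (hx : x ∈ l) :
    x = a ∨ ∃ y, W.E y x :=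
  mem_of_isChain (τ := {x | ∃ y, W.E y x}) (fun y _ h => ⟨y, h⟩) h.chain h.head hx

/-- The sources in `M` are the starting points of disjoint links in `M`. -/
def Linked (W : Web V) (M : Set V) : Prop :=
  ∃ L : V → List V, ∀ a ∈ W.A, a ∈ M → W.IsLink a (L a) ∧ (∀ x ∈ L a, x ∈ M) ∧
    ∀ a' ∈ W.A, a' ∈ M → a ≠ a' → List.Disjoint (L a) (L a')

theorem Linked.of_subset {M N : Set V} (h : W.Linked M) (hMN : M ⊆ N) (hA : W.A ∩ N ⊆ M) :
    W.Linked N := by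
  obtain ⟨L, hL⟩ := h
  refine ⟨L, fun a ha haN => ?_⟩
  obtain ⟨h1, h2, h3⟩ := hL a ha (hA ⟨ha, haN⟩)
  exact ⟨h1, fun x hx => hMN (h2 x hx), fun a' ha' haN' => h3 a' ha' (hA ⟨ha', haN'⟩)⟩

theorem linked_iUnion {ι : Type*} [LinearOrder ι] [WellFoundedLT ι] {f : ι → Set V}
    (h : ∀ i, (W.del (⋃ k < i, f k)).Linked (f i)) : W.Linked (⋃ i, f i) := by
  classical
  choose L hL using h
  have hleast : ∀ a : V, ∃ i : Option ι, a ∈ ⋃ i, f i →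
      ∃ j, i = some j ∧ a ∈ f j ∧ a ∉ ⋃ k < j, f k := by
    intro a
    by_cases ha : a ∈ ⋃ i, f i
    · obtain ⟨j, hj, hmin⟩ := wellFounded_lt.has_min {i | a ∈ f i} (Set.mem_iUnion.1 ha)
      refine ⟨some j, fun _ => ⟨j, rfl, hj, fun h => ?_⟩⟩
      obtain ⟨k, hk, hak⟩ := Set.mem_iUnion₂.1 h
      exact hmin k hak hk
    · exact ⟨none, fun h => absurd h ha⟩
  choose idx hidx using hleast
  refine ⟨fun a => (idx a).elim [] fun i => L i a, fun a ha haM => ?_⟩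
  obtain ⟨i, hi, hai, haU⟩ := hidx a haM
  have hout : ∀ i a, a ∈ W.A → a ∈ f i → a ∉ (⋃ k < i, f k) →
      ∀ x ∈ L i a, x ∉ ⋃ k < i, f k := by
    intro i a ha hai haU x hx
    rcases (hL i a ⟨ha, haU⟩ hai).1.mem_cases hx with rfl | ⟨y, hy⟩
    · exact haU
    · exact hy.2.2
  obtain ⟨h1, h2, h3⟩ := hL i a ⟨ha, haU⟩ hai
  simp only [hi, Option.elim_some]
  refine ⟨h1.of_del, fun x hx => Set.mem_iUnion.2 ⟨i, h2 x hx⟩, fun a' ha' haM' hne => ?_⟩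
  obtain ⟨j, hj, haj, haU'⟩ := hidx a' haM'
  simp only [hj, Option.elim_some]
  intro x hx hx'
  rcases lt_trichotomy i j with hij | rfl | hij
  · exact hout j a' ha' haj haU' x hx' (Set.mem_iUnion₂.2 ⟨i, hij, h2 x hx⟩)
  · exact h3 a' ⟨ha', haU'⟩ haj hne hx hx'
  · exact hout i a ha hai haU x hx
      (Set.mem_iUnion₂.2 ⟨j, hij, (hL j a' ⟨ha', haU'⟩ haj).2.1 x hx'⟩)

open Cardinal in
theorem exists_linked_countable (h : ¬ W.Hindered) {Φ : Finset V → Set V} (hΦ : ∀ s, #(Φ s) ≤ ℵ₀)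
    {X : Set V} (hX : #X ≤ ℵ₀) :
    ∃ M, X ⊆ M ∧ #M ≤ ℵ₀ ∧ ClosedUnder Φ M ∧ W.Linked M := by
  classical
  have hex : ∀ (P : Finset V) (a : V), ∃ l : List V, a ∈ W.A → a ∉ P → ¬ (W.del ↑P).Hindered →
      (W.del ↑P).IsLink a l ∧ ¬ (W.del (↑P ∪ {x | x ∈ l})).Hindered := by
    intro P a
    by_cases hc : a ∈ W.A ∧ a ∉ P ∧ ¬ (W.del ↑P).Hindered
    · obtain ⟨l, hl, hl'⟩ := exists_safe_link hc.2.2 (a := a) ⟨hc.1, hc.2.1⟩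
      rw [del_del] at hl'
      exact ⟨l, fun _ _ _ => ⟨hl, hl'⟩⟩
    · exact ⟨[], fun h1 h2 h3 => absurd ⟨h1, h2, h3⟩ hc⟩
  choose l hl using hex
  set Θ : Finset V → Set V := fun s => Φ s ∪
    ⋃ q : {q : Finset V × V // q.1 ⊆ s ∧ q.2 ∈ s}, {x | x ∈ l q.1.1 q.1.2} with hΘ
  have hΘc : ∀ s, #(Θ s) ≤ ℵ₀ := by
    intro s
    have : Finite {q : Finset V × V // q.1 ⊆ s ∧ q.2 ∈ s} :=
      ((s.powerset ×ˢ s).finite_toSet.subset fun q hq => Finset.mem_coe.2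
        (Finset.mem_product.2 ⟨Finset.mem_powerset.2 hq.1, hq.2⟩))
    refine mk_union_le_of_le le_rfl (hΦ s) (mk_iUnion_le_of_le le_rfl
      (lt_aleph0_of_finite _).le fun q => ?_)
    exact (mk_lt_of_finite le_rfl (List.finite_toSet _)).le
  set M := clos Θ X with hM
  have hMc : #M ≤ ℵ₀ := mk_clos_le le_rfl hX hΘc
  have hMcl : ClosedUnder Θ M := closedUnder_clos Θ X
  refine ⟨M, subset_clos Θ X, hMc, fun s hs => Set.subset_union_left.trans (hMcl s hs), ?_⟩
  rcases M.eq_empty_or_nonempty with hM0 | hM0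
  · exact ⟨fun _ => [], fun a _ ha => absurd ha (by rw [hM0]; simp)⟩
  obtain ⟨e, he⟩ := (le_aleph0_iff_set_countable.1 hMc).exists_eq_range hM0
  have hstep : ∀ n (U : Finset V), (↑U : Set V) ⊆ M → ¬ (W.del ↑U).Hindered →
      ∃ N : Set V, N.Finite ∧ ↑U ⊆ N ∧ N ⊆ M ∧ ¬ (W.del N).Hindered ∧ (W.del ↑U).Linked N ∧
        (e n ∈ W.A → e n ∈ N) := by
    intro n U hU hUh
    by_cases ha : e n ∈ W.A ∧ e n ∉ U
    · obtain ⟨h1, h2⟩ := hl U (e n) ha.1 ha.2 hUh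
      have hmem : e n ∈ l U (e n) := List.mem_of_mem_head? h1.head
      refine ⟨↑U ∪ {x | x ∈ l U (e n)}, U.finite_toSet.union (List.finite_toSet _),
        Set.subset_union_left, Set.union_subset hU ?_, h2, ?_, fun _ => Or.inr hmem⟩
      · have hs : (↑(insert (e n) U) : Set V) ⊆ M := by
          rw [Finset.coe_insert]
          exact Set.insert_subset (he ▸ Set.mem_range_self n) hU
        refine subset_trans ?_ (hMcl _ hs)
        exact fun x hx => Or.inr (Set.mem_iUnion.2 ⟨⟨(U, e n), by simp, by simp⟩, hx⟩)
      · have huniq : ∀ a ∈ (W.del ↑U).A, a ∈ (↑U ∪ {x | x ∈ l U (e n)} : Set V) → a = e n := by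
          rintro a ha (hau | hal)
          · exact absurd hau ha.2
          · rcases h1.mem_cases hal with h | ⟨y, hy⟩
            · exact h
            · exact absurd ha ((W.del ↑U).noIn _ _ hy)
        refine ⟨fun _ => l U (e n), fun a haA haN => ⟨?_, fun x hx => Or.inr hx, ?_⟩⟩
        · rw [huniq a haA haN]
          exact h1
        · exact fun a' haA' haN' hne =>
            absurd ((huniq a haA haN).trans (huniq a' haA' haN').symm) hne
    · refine ⟨↑U, U.finite_toSet, subset_rfl, hU, hUh, ⟨fun _ => [], fun a ha haU =>
        absurd haU ha.2⟩, fun h => ?_⟩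
      by_contra hn
      exact ha ⟨h, hn⟩
  refine Exists.elim (exists_chain (ι := ℕ) (fun n U N => N.Finite ∧ U ⊆ N ∧ N ⊆ M ∧
    ¬ (W.del N).Hindered ∧ (W.del U).Linked N ∧ (e n ∈ W.A → e n ∈ N)) ?_) ?_
  · intro j f hf
    rcases j with _ | j
    · simpa using hstep 0 ∅ (by simp) (by simpa [del_empty] using h)
    · rw [biUnion_lt_succ (hf j j.lt_succ_self).2.1]
      obtain ⟨hfin, -, h1, h2, -⟩ := hf j j.lt_succ_self
      obtain ⟨U, hU⟩ := hfin.exists_finset_coe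
      rw [← hU] at h1 h2 ⊢
      exact hstep _ U h1 h2
  · intro f hf
    refine (linked_iUnion fun n => (hf n).2.2.2.2.1).of_subset
      (Set.iUnion_subset fun n => (hf n).2.2.1) ?_
    rintro a ⟨ha, haM⟩
    rw [he] at haM
    obtain ⟨n, rfl⟩ := haM
    exact Set.mem_iUnion.2 ⟨n, (hf n).2.2.2.2.2 ha⟩

end Web

open Cardinal in
theorem mk_values_lt {Φ : Finset V → Set V} {S : Set V} {κ : Cardinal.{u}} (hreg : κ.IsRegular)
    (hκ : ℵ₀ < κ) (hS : #S < κ) (hΦ : ∀ s, #(Φ s) < κ) : #(values Φ S) < κ := by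
  refine (card_iUnion_lt_iff_forall_of_isRegular hreg ?_).2 fun s => hΦ _
  exact (mk_finset_le_of_le (le_max_right (#S) ℵ₀) (le_max_left _ _)).trans_lt (max_lt hS hκ)

open Cardinal in
theorem mk_iUnion_nat_lt {f : ℕ → Set V} {κ : Cardinal.{u}} (hreg : κ.IsRegular)
    (hκ : ℵ₀ < κ) (h : ∀ n, #(f n) < κ) : #(⋃ n, f n : Set V) < κ := by
  have : (⋃ i, f i : Set V) = ⋃ i : ULift.{u} ℕ, f i.down := by
    ext x; simp
  rw [this]
  exact (card_iUnion_lt_iff_forall_of_isRegular hreg (by simpa using hκ)).2 fun n => h _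

theorem biUnion_lt_eq {ι : Type*} [LinearOrder ι] (f : ι → Set V) (i : ι) :
    ⋃ k < i, f k = ⋃ k : Set.Iio i, f k := by
  ext; simp

theorem exists_lt_subset {ι : Type*} [LinearOrder ι] {f : ι → Set V} {i : ι} (hi : ∃ k, k < i)
    (hf : ∀ k < i, (⋃ j < k, f j) ⊆ f k) {s : Finset V} (hs : (s : Set V) ⊆ ⋃ k < i, f k) :
    ∃ k < i, (s : Set V) ⊆ f k := by
  obtain ⟨k₀, hk₀⟩ := hi
  have : Nonempty (Set.Iio i) := ⟨⟨k₀, hk₀⟩⟩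
  rw [biUnion_lt_eq] at hs
  have hmono : Monotone fun k : Set.Iio i => f k := by
    intro j k hjk
    rcases hjk.eq_or_lt with rfl | hjk
    · exact subset_rfl
    · exact fun z hz => hf k k.2 (Set.mem_iUnion₂.2 ⟨j, hjk, hz⟩)
  obtain ⟨k, hk⟩ := exists_subset_of_chain hmono s hs
  exact ⟨k, k.2, hk⟩

theorem biUnion_lt_eq_empty {ι : Type*} [LinearOrder ι] {f : ι → Set V} {i : ι}
    (hi : ¬ ∃ k, k < i) : ⋃ k < i, f k = ∅ := by
  rw [Set.eq_empty_iff_forall_notMem]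
  intro x hx
  obtain ⟨k, hk, -⟩ := Set.mem_iUnion₂.1 hx
  exact hi ⟨k, hk⟩

namespace Web
variable {W : Web V}

open Cardinal in
/-- In unhindered webs, sets of size at most `μ` extend to linked closed sets of size at
most `μ`. -/
def HasLinkedClosures (V : Type u) (μ : Cardinal.{u}) : Prop :=
  ∀ W : Web V, ¬ W.Hindered → ∀ Φ : Finset V → Set V, (∀ s, #(Φ s) ≤ μ) → ∀ X : Set V, #X ≤ μ →
    ∃ M, X ⊆ M ∧ #M ≤ μ ∧ ClosedUnder Φ M ∧ W.Linked M

open Cardinal in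
theorem exists_club_succ (h : ¬ W.Hindered) {ν : Cardinal.{u}} (hν : ℵ₀ ≤ ν) :
    ∃ Φ : Finset V → Set V, (∀ s, #(Φ s) ≤ ν) ∧
      ∀ Z : Set V, #Z ≤ ν → ClosedUnder Φ Z → ¬ (W.del Z).Hindered := by
  simpa only [Order.lt_succ_iff] using exists_club (isRegular_succ hν) h

open Cardinal in
theorem exists_linked_lt {κ : Cardinal.{u}} (hreg : κ.IsRegular) (hκ : ℵ₀ < κ)
    (ih : ∀ ν < κ, ℵ₀ ≤ ν → HasLinkedClosures V ν) (h : ¬ W.Hindered) {Φ : Finset V → Set V}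
    (hΦ : ∀ s, #(Φ s) < κ) {X : Set V} (hX : #X < κ) :
    ∃ M, X ⊆ M ∧ #M < κ ∧ ClosedUnder Φ M ∧ W.Linked M := by
  have hstep : ∀ U : Set V, #U < κ → ¬ (W.del U).Hindered → ∃ N : Set V, #N < κ ∧ U ⊆ N ∧ X ⊆ N ∧
      values Φ U ⊆ N ∧ ¬ (W.del N).Hindered ∧ (W.del U).Linked N := by
    intro U hU hUh
    set Y := U ∪ (X ∪ values Φ U) with hY
    have hYc : #Y < κ := mk_union_lt_of_lt hκ.le hU
      (mk_union_lt_of_lt hκ.le hX (mk_values_lt hreg hκ hU hΦ))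
    obtain ⟨Ψ, hΨ, hΨ'⟩ := exists_club_succ h (le_max_right (#Y) ℵ₀)
    obtain ⟨N, hN, hNc, hcl, hl⟩ := ih _ (max_lt hYc hκ) (le_max_right _ _) (W.del U) hUh Ψ hΨ Y
      (le_max_left _ _)
    rw [hY, Set.union_subset_iff, Set.union_subset_iff] at hN
    exact ⟨N, hNc.trans_lt (max_lt hYc hκ), hN.1, hN.2.1, hN.2.2, hΨ' N hNc hcl, hl⟩
  refine Exists.elim (exists_chain (ι := ℕ) (fun _ U N => #N < κ ∧ U ⊆ N ∧ X ⊆ N ∧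
      values Φ U ⊆ N ∧ ¬ (W.del N).Hindered ∧ (W.del U).Linked N) ?_) ?_
  · intro j f hf
    rcases j with _ | j
    · simpa using hstep ∅ (mk_lt_of_finite hκ.le Set.finite_empty) (by simpa [del_empty] using h)
    · obtain ⟨h1, h2, -, -, h3, -⟩ := hf j j.lt_succ_self
      rw [biUnion_lt_succ h2]
      exact hstep _ h1 h3
  · intro f hf
    refine ⟨⋃ n, f n, (hf 0).2.2.1.trans (Set.subset_iUnion f 0),
      mk_iUnion_nat_lt hreg hκ fun n => (hf n).1, ?_, linked_iUnion fun n => (hf n).2.2.2.2.2⟩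
    refine closedUnder_iUnion_nat (monotone_of_biUnion_subset fun n => (hf n).2.1) fun n s hs => ?_
    have := (hf (n + 1)).2.2.2.1
    rw [biUnion_lt_succ (hf n).2.1] at this
    exact (subset_values hs).trans this

open Cardinal in
theorem hasLinkedClosures_of_isRegular {κ : Cardinal.{u}} (hreg : κ.IsRegular) (hκ : ℵ₀ < κ)
    (ih : ∀ ν < κ, ℵ₀ ≤ ν → HasLinkedClosures V ν) : HasLinkedClosures V κ := by
  intro W h Φ hΦ X hX
  have hcov : ∀ T : Set V, #T ≤ κ → ∃ e : κ.ord.ToType → Set V, (∀ ξ, (e ξ).Finite) ∧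
      ∀ y ∈ T, ∃ ξ ∈ Set.univ, y ∈ e ξ := fun T hT =>
    exists_finite_cover (by rwa [mk_univ, mk_ord_toType])
  obtain ⟨x, hxf, hx⟩ := hcov X hX
  choose φ hφf hφ using fun s => hcov (Φ s) (hΦ s)
  obtain ⟨Ψ, hΨ, hΨ'⟩ := exists_club hreg h
  obtain ⟨b, hb⟩ := exists_bookkeeping hκ.le
  have hnm : ∀ i : κ.ord.ToType, ∃ j, i < j := fun i => (hb (i, i)).imp fun j hj => hj.1
  refine Exists.elim (exists_chain (ι := κ.ord.ToType) (fun i U N => #N < κ ∧ ClosedUnder Ψ N ∧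
    U ⊆ N ∧ (∀ ξ ≤ i, x ξ ⊆ N) ∧ (∀ ξ ≤ i, ∀ s : Finset V, ↑s ⊆ U → φ s ξ ⊆ N) ∧
    (W.del U).Linked N) ?_) ?_
  · intro i f hf
    set U := ⋃ k < i, f k with hU
    have hUc : #U < κ := by
      rw [hU, biUnion_lt_eq]
      exact (card_iUnion_lt_iff_forall_of_isRegular hreg (mk_Iio_ord_lt i)).2
        fun k => (hf k k.2).1
    have hUh : ¬ (W.del U).Hindered := by
      by_cases hi : ∃ k, k < i
      · refine hΨ' U hUc fun s hs => ?_
        obtain ⟨k, hk, hsk⟩ := exists_lt_subset hi (fun k hk => (hf k hk).2.2.1) hs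
        exact fun z hz => Set.mem_iUnion₂.2 ⟨k, hk, (hf k hk).2.1 s hsk hz⟩
      · rwa [hU, biUnion_lt_eq_empty hi, del_empty]
    have hIic : ∀ g : κ.ord.ToType → Set V, (∀ ξ, (g ξ).Finite) →
        #(⋃ ξ : Set.Iic i, g ξ : Set V) < κ := fun g hg =>
      (card_iUnion_lt_iff_forall_of_isRegular hreg (mk_Iic_toType_ord_lt hκ.le i)).2
        fun ξ => mk_lt_of_finite hκ.le (hg ξ)
    have hvc := mk_values_lt (Φ := fun s => ⋃ ξ : Set.Iic i, φ s ξ) hreg hκ hUc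
      fun s => hIic _ (hφf s)
    obtain ⟨N, hN, hNc, hcl, hl⟩ := exists_linked_lt hreg hκ ih hUh hΨ
      (mk_union_lt_of_lt hκ.le hUc (mk_union_lt_of_lt hκ.le (hIic x hxf) hvc))
    rw [Set.union_subset_iff, Set.union_subset_iff] at hN
    refine ⟨N, hNc, hcl, hN.1, fun ξ hξ => ?_, fun ξ hξ s hs => ?_, hl⟩
    · exact (Set.subset_iUnion (fun ξ : Set.Iic i => x ξ) ⟨ξ, hξ⟩).trans hN.2.1
    · refine subset_trans ?_ ((subset_values hs).trans hN.2.2)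
      exact Set.subset_iUnion (fun ξ : Set.Iic i => φ s ξ) ⟨ξ, hξ⟩
  · intro f hf
    have hmono : Monotone f := monotone_of_biUnion_subset fun i => (hf i).2.2.1
    have hne : Nonempty κ.ord.ToType := by
      rw [← mk_ne_zero_iff, mk_ord_toType]
      exact hreg.pos.ne'
    refine ⟨⋃ i, f i, fun y hy => ?_, ?_, fun s hs y hy => ?_, linked_iUnion fun i =>
      (hf i).2.2.2.2.2⟩
    · obtain ⟨ξ, -, hξ⟩ := hx y hy
      exact Set.mem_iUnion.2 ⟨ξ, (hf ξ).2.2.2.1 ξ le_rfl hξ⟩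
    · exact mk_iUnion_le_of_le hκ.le (mk_ord_toType κ).le fun i => (hf i).1.le
    · obtain ⟨i, hi⟩ := exists_subset_of_chain hmono s hs
      obtain ⟨ξ, -, hξ⟩ := hφ s y hy
      obtain ⟨j, hj⟩ := hnm (max i ξ)
      refine Set.mem_iUnion.2 ⟨j, (hf j).2.2.2.2.1 ξ ((le_max_right _ _).trans hj.le) s ?_ hξ⟩
      exact hi.trans (Set.subset_iUnion₂ (s := fun k (_ : k < j) => f k) i
        ((le_max_left _ _).trans_lt hj))

end Web

namespace Web
variable {W : Web V}

open Cardinal in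
theorem hasLinkedClosures_of_not_isRegular {μ : Cardinal.{u}} (hμ : ℵ₀ ≤ μ) (hsing : ¬ μ.IsRegular)
    (ih : ∀ ν < μ, ℵ₀ ≤ ν → HasLinkedClosures V ν) : HasLinkedClosures V μ := by
  intro W h Φ hΦ X hX
  obtain ⟨S, hScof, hScard⟩ := Order.exists_cof_eq μ.ord.ToType
  have hSμ : #S < μ := by
    rw [hScard, Ordinal.cof_toType]
    by_contra hle
    exact hsing ⟨hμ, not_lt.1 hle⟩
  obtain ⟨b, hb⟩ := exists_bookkeeping hμ
  have hnm : ∀ i : μ.ord.ToType, ∃ j, i < j := fun i => (hb (i, i)).imp fun j hj => hj.1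
  have hne : Nonempty μ.ord.ToType := by
    rw [← mk_ne_zero_iff, mk_ord_toType]
    exact (aleph0_pos.trans_le hμ).ne'
  have hSinf : ℵ₀ ≤ #S := by
    by_contra hfin
    obtain ⟨m, hm⟩ := (lt_aleph0_iff_set_finite.1 (not_le.1 hfin)).bddAbove
    obtain ⟨j, hj⟩ := hnm m
    obtain ⟨s, hs, hjs⟩ := hScof j
    exact absurd (hjs.trans (hm hs)) (not_le.2 hj)
  set Λ : S → Set μ.ord.ToType := fun i => Set.Iic i.1 ∪ S with hΛ
  have hΛμ : ∀ i, #(Λ i) < μ := fun i => mk_union_lt_of_lt hμ (mk_Iic_toType_ord_lt hμ _) hSμ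
  have hSΛ : ∀ i, #S ≤ #(Λ i) := fun i => mk_le_mk_of_subset Set.subset_union_right
  have hΛmono : Monotone Λ := fun i j hij =>
    Set.union_subset_union_left _ (Set.Iic_subset_Iic.2 hij)
  set Ξ : S → Set μ.ord.ToType := fun i => ⋃ k < i, Λ k with hΞ
  have hΛΞ : ∀ k i, k < i → Λ k ⊆ Ξ i := fun k i hk =>
    Set.subset_iUnion₂ (s := fun k (_ : k < i) => Λ k) k hk
  have hcov : ∀ T : Set V, #T ≤ μ → ∃ e : μ.ord.ToType → Set V, (∀ ξ, (e ξ).Finite) ∧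
      ∀ y ∈ T, ∃ ξ ∈ Set.univ, y ∈ e ξ := fun T hT =>
    exists_finite_cover (by rwa [mk_univ, mk_ord_toType])
  obtain ⟨x, hxf, hx⟩ := hcov X hX
  choose φ hφf hφ using fun s => hcov (Φ s) (hΦ s)
  have hclub : ∀ i, ∃ (Ψ : Finset V → Set V) (e : Finset V → μ.ord.ToType → Set V),
      (∀ s ξ, (e s ξ).Finite) ∧ ((∃ k, k < i) → (∀ s, ∀ y ∈ Ψ s, ∃ ξ ∈ Ξ i, y ∈ e s ξ) ∧
        ∀ Z : Set V, #Z ≤ #(Ξ i) → ClosedUnder Ψ Z → ¬ (W.del Z).Hindered) := by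
    intro i
    by_cases hi : ∃ k, k < i
    · obtain ⟨k, hk⟩ := hi
      obtain ⟨Ψ, hΨ, hΨ'⟩ := exists_club_succ h
        ((hSinf.trans (hSΛ k)).trans (mk_le_mk_of_subset (hΛΞ k i hk)))
      choose e he he' using fun s => exists_finite_cover (hΨ s)
      exact ⟨Ψ, e, he, fun _ => ⟨he', hΨ'⟩⟩
    · exact ⟨fun _ => ∅, fun _ _ => ∅, fun _ _ => Set.finite_empty, fun h => absurd h hi⟩
  choose Ψ e hef hΨ using hclub
  refine Exists.elim (exists_chain (ι := S) (fun i U N => #N ≤ #(Λ i) ∧ U ⊆ N ∧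
    (∀ ξ ∈ Λ i, x ξ ⊆ N) ∧ (∀ ξ ∈ Λ i, ∀ s : Finset V, ↑s ⊆ N → φ s ξ ⊆ N) ∧
    (∀ k, ∀ ξ ∈ Λ i, ∀ s : Finset V, ↑s ⊆ N → e k s ξ ⊆ N) ∧ (W.del U).Linked N) ?_) ?_
  · intro i f hf
    set U := ⋃ k < i, f k with hU
    have hUΞ : (∃ k, k < i) → #U ≤ #(Ξ i) := by
      rintro ⟨k₀, hk₀⟩
      have hS' : #S ≤ #(Ξ i) := (hSΛ k₀).trans (mk_le_mk_of_subset (hΛΞ k₀ i hk₀))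
      rw [hU, biUnion_lt_eq]
      exact mk_iUnion_le_of_le (hSinf.trans hS') ((mk_subtype_le _).trans hS')
        fun k => (hf k k.2).1.trans (mk_le_mk_of_subset (hΛΞ k i k.2))
    have hΛinf : ℵ₀ ≤ #(Λ i) := hSinf.trans (hSΛ i)
    have hUΛ : #U ≤ #(Λ i) := by
      by_cases hi : ∃ k, k < i
      · exact (hUΞ hi).trans
          (mk_le_mk_of_subset (Set.iUnion₂_subset fun k hk => hΛmono hk.le))
      · rw [hU, biUnion_lt_eq_empty hi]
        exact (mk_lt_of_finite hΛinf Set.finite_empty).le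
    have hUh : ¬ (W.del U).Hindered := by
      by_cases hi : ∃ k, k < i
      · refine (hΨ i hi).2 U (hUΞ hi) fun s hs y hy => ?_
        obtain ⟨k, hk, hsk⟩ := exists_lt_subset hi (fun k hk => (hf k hk).2.1) hs
        obtain ⟨ξ, hξ, hyξ⟩ := (hΨ i hi).1 s y hy
        obtain ⟨j, hj, hξj⟩ := Set.mem_iUnion₂.1 hξ
        rcases le_total k j with hkj | hkj
        · refine Set.mem_iUnion₂.2 ⟨j, hj, (hf j hj).2.2.2.2.1 i ξ hξj s (hsk.trans ?_) hyξ⟩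
          rcases hkj.eq_or_lt with rfl | hkj
          · exact subset_rfl
          · exact fun z hz => (hf j hj).2.1 (Set.mem_iUnion₂.2 ⟨k, hkj, hz⟩)
        · exact Set.mem_iUnion₂.2 ⟨k, hk, (hf k hk).2.2.2.2.1 i ξ (hΛmono hkj hξj) s hsk hyξ⟩
      · rwa [hU, biUnion_lt_eq_empty hi, del_empty]
    obtain ⟨N, hN, hNc, hcl, hl⟩ := ih _ (hΛμ i) hΛinf (W.del U) hUh
      (fun s => ⋃ ξ : Λ i, (φ s ξ ∪ ⋃ k : S, e k s ξ))
      (fun s => mk_iUnion_le_of_le hΛinf le_rfl fun ξ => mk_union_le_of_le hΛinf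
        (mk_lt_of_finite hΛinf (hφf _ _)).le
        (mk_iUnion_le_of_le hΛinf (hSΛ i) fun k => (mk_lt_of_finite hΛinf (hef _ _ _)).le))
      (U ∪ ⋃ ξ : Λ i, x ξ) (mk_union_le_of_le hΛinf hUΛ (mk_iUnion_le_of_le hΛinf le_rfl
        fun ξ => (mk_lt_of_finite hΛinf (hxf _)).le))
    rw [Set.union_subset_iff] at hN
    refine ⟨N, hNc, hN.1, fun ξ hξ => ?_, fun ξ hξ s hs y hy => ?_, fun k ξ hξ s hs y hy => ?_, hl⟩
    · exact (Set.subset_iUnion (fun ξ : Λ i => x ξ) ⟨ξ, hξ⟩).trans hN.2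
    · exact hcl s hs (Set.mem_iUnion.2 ⟨⟨ξ, hξ⟩, Or.inl hy⟩)
    · exact hcl s hs (Set.mem_iUnion.2 ⟨⟨ξ, hξ⟩, Or.inr (Set.mem_iUnion.2 ⟨k, hy⟩)⟩)
  · intro f hf
    have hmono : Monotone f := monotone_of_biUnion_subset fun i => (hf i).2.1
    have hΛcov : ∀ ξ, ∃ i, ξ ∈ Λ i := fun ξ => by
      obtain ⟨s, hs, hξs⟩ := hScof ξ
      exact ⟨⟨s, hs⟩, Or.inl hξs⟩
    have hSne : Nonempty S := (hΛcov hne.some).nonempty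
    refine ⟨⋃ i, f i, fun y hy => ?_, ?_, fun s hs y hy => ?_, linked_iUnion fun i =>
      (hf i).2.2.2.2.2⟩
    · obtain ⟨ξ, -, hξ⟩ := hx y hy
      obtain ⟨i, hi⟩ := hΛcov ξ
      exact Set.mem_iUnion.2 ⟨i, (hf i).2.2.1 ξ hi hξ⟩
    · exact mk_iUnion_le_of_le hμ hSμ.le fun i => (hf i).1.trans (hΛμ i).le
    · obtain ⟨i, hi⟩ := exists_subset_of_chain hmono s hs
      obtain ⟨ξ, -, hξ⟩ := hφ s y hy
      obtain ⟨j, hj⟩ := hΛcov ξ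
      refine Set.mem_iUnion.2 ⟨max i j, (hf (max i j)).2.2.2.1 ξ (hΛmono (le_max_right _ _) hj) s
        (hi.trans (hmono (le_max_left _ _))) hξ⟩

open Cardinal in
theorem hasLinkedClosures {μ : Cardinal.{u}} (hμ : ℵ₀ ≤ μ) : HasLinkedClosures V μ := by
  induction μ using WellFoundedLT.induction with
  | _ μ ih =>
    rcases hμ.eq_or_lt with rfl | hlt
    · exact fun W h Φ hΦ X hX => exists_linked_countable h hΦ hX
    by_cases hreg : μ.IsRegular
    · exact hasLinkedClosures_of_isRegular hreg hlt fun ν hν h => ih ν hν h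
    · exact hasLinkedClosures_of_not_isRegular hμ hreg fun ν hν h => ih ν hν h

open Cardinal in
/-- All sources of an unhindered web are the starting points of disjoint links. -/
theorem linked_univ (h : ¬ W.Hindered) : W.Linked Set.univ := by
  obtain ⟨M, hM, -, -, hl⟩ := hasLinkedClosures (le_max_right (#V) ℵ₀) W h (fun _ => ∅)
    (fun s => (mk_lt_of_finite (le_max_right _ _) Set.finite_empty).le) Set.univ
    (mk_univ.le.trans (le_max_left _ _))
  rwa [Set.univ_subset_iff.1 hM] at hl

end Web

theorem isPathIn_iff {D : Set (V × V)} {P : DiPath V} :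
    IsPathIn D P ↔ P.verts.IsChain fun x y => (x, y) ∈ D := by
  have key : ∀ l : List V, {e | e ∈ l.zip l.tail} ⊆ D ↔ l.IsChain fun x y => (x, y) ∈ D := by
    intro l
    induction l with
    | nil => simp
    | cons a l ih =>
      cases l with
      | nil => simp
      | cons b l =>
        rw [List.isChain_cons_cons, ← ih]
        simp [Set.subset_def]
  exact key P.verts

theorem isPath_verts {D : Set (V × V)} {a b : V} {P : DiPath V} (h : IsPath D a b P) :
    ∃ h0 : 0 < P.verts.length, P.verts[0] = a ∧ P.verts[P.verts.length - 1] = b := by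
  refine ⟨List.length_pos_iff.2 P.ne, ?_, ?_⟩
  · rw [← h.2.1, DiPath.first, List.head_eq_getElem]
  · rw [← h.2.2, DiPath.last, List.getLast_eq_getElem]

/-- A successor function `n` on `C` describing disjoint paths inside `B` from the entrance of `B`
to `v`. -/
structure IsFlow (D : Set (V × V)) (v : V) (B C : Set V) (n : V → V) : Prop where
  subset : C ⊆ B
  entrance : entrance D B ⊆ C
  edge : ∀ x ∈ C, x ≠ v → (x, n x) ∈ D
  mem : ∀ x ∈ C, x ≠ v → n x ∈ C
  inj : ∀ x ∈ C, ∀ y ∈ C, x ≠ v → y ≠ v → n x = n y → n x ≠ v → x = y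
  start : ∀ x ∈ C, x ≠ v → n x ∈ FlamePaper.entrance D B → n x = v
  reach : ∀ x ∈ C, ∃ k, n^[k] x = v

theorem IsBubble.exists_isFlow {D : Set (V × V)} {r v : V} {B : Set V} (h : IsBubble D r v B) :
    ∃ C n, IsFlow D v B C n := by
  classical
  obtain ⟨-, F, hF, hdisj⟩ := h
  have hunique : ∀ x, x ≠ v → ∀ u ∈ entrance D B, ∀ w ∈ entrance D B, x ∈ (F u).verts →
      x ∈ (F w).verts → u = w := by
    intro x hx u hu w hw hxu hxw
    by_contra hne
    have : x ∈ (F u).vertexSet ∩ (F w).vertexSet := ⟨hxu, hxw⟩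
    rw [hdisj u hu w hw hne] at this
    exact hx this
  have hex : ∀ x, ∃ y, x ≠ v → ∀ u ∈ entrance D B, ∀ i (hi : i < (F u).verts.length),
      (F u).verts[i] = x → ∃ hi' : i + 1 < (F u).verts.length, (F u).verts[i + 1] = y := by
    intro x
    by_cases hc : x ≠ v ∧ ∃ u ∈ entrance D B, x ∈ (F u).verts
    · obtain ⟨hxv, u, hu, hxu⟩ := hc
      obtain ⟨i, hi, hix⟩ := List.getElem_of_mem hxu
      have hi' : i + 1 < (F u).verts.length := by
        by_contra hlt
        obtain ⟨h0, -, hl⟩ := isPath_verts (hF u hu)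
        have : i = (F u).verts.length - 1 := by omega
        subst this
        exact hxv (hix.symm.trans hl)
      refine ⟨(F u).verts[i + 1], fun _ w hw j hj hjx => ?_⟩
      obtain rfl := hunique x hxv u hu w hw hxu (hjx ▸ List.getElem_mem hj)
      obtain rfl := ((F u).nodup.getElem_inj_iff).1 (hix.trans hjx.symm)
      exact ⟨hi', rfl⟩
    · refine ⟨x, fun hxv u hu i hi hix => absurd ⟨hxv, u, hu, hix ▸ List.getElem_mem hi⟩ hc⟩
  choose n hn using hex
  have hlast : ∀ u ∈ entrance D B, v ∈ (F u).verts := fun u hu => by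
    obtain ⟨h0, -, hl⟩ := isPath_verts (hF u hu)
    exact hl ▸ List.getElem_mem _
  have hchain : ∀ u ∈ entrance D B, ∀ i (hi : i + 1 < (F u).verts.length),
      ((F u).verts[i], (F u).verts[i + 1]) ∈ D ∩ B ×ˢ B := fun u hu i hi =>
    List.isChain_iff_getElem.1 (isPathIn_iff.1 (hF u hu).1) i hi
  have hinB : ∀ u ∈ entrance D B, ∀ i (hi : i < (F u).verts.length), (F u).verts[i] ∈ B := by
    intro u hu i hi
    rcases i with _ | i
    · obtain ⟨h0, hf, -⟩ := isPath_verts (hF u hu)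
      rw [hf]
      exact hu.1
    · exact (hchain u hu i hi).2.2
  refine ⟨{x | ∃ u ∈ entrance D B, x ∈ (F u).verts}, n, ?_, ?_, ?_, ?_, ?_, ?_, ?_⟩
  · rintro x ⟨u, hu, hx⟩
    obtain ⟨i, hi, rfl⟩ := List.getElem_of_mem hx
    exact hinB u hu i hi
  · intro u hu
    obtain ⟨h0, hf, -⟩ := isPath_verts (hF u hu)
    exact ⟨u, hu, List.mem_of_getElem hf⟩
  · rintro x ⟨u, hu, hx⟩ hxv
    obtain ⟨i, hi, hix⟩ := List.getElem_of_mem hx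
    obtain ⟨hi', h⟩ := hn x hxv u hu i hi hix
    rw [← h, ← hix]
    exact (hchain u hu i hi').1
  · rintro x ⟨u, hu, hx⟩ hxv
    obtain ⟨i, hi, hix⟩ := List.getElem_of_mem hx
    obtain ⟨hi', h⟩ := hn x hxv u hu i hi hix
    exact ⟨u, hu, List.mem_of_getElem h⟩
  · rintro x ⟨u, hu, hx⟩ y ⟨w, hw, hy⟩ hxv hyv hxy hnv
    obtain ⟨i, hi, hix⟩ := List.getElem_of_mem hx
    obtain ⟨j, hj, hjy⟩ := List.getElem_of_mem hy
    obtain ⟨hi', h⟩ := hn x hxv u hu i hi hix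
    obtain ⟨hj', h'⟩ := hn y hyv w hw j hj hjy
    obtain rfl := hunique (n x) hnv u hu w hw (List.mem_of_getElem h)
      (List.mem_of_getElem (h'.trans hxy.symm))
    have := ((F u).nodup.getElem_inj_iff).1 (h.trans (hxy.trans h'.symm))
    obtain rfl : i = j := by omega
    exact hix.symm.trans hjy
  · rintro x ⟨u, hu, hx⟩ hxv hent
    by_contra hnv
    obtain ⟨i, hi, hix⟩ := List.getElem_of_mem hx
    obtain ⟨hi', h⟩ := hn x hxv u hu i hi hix
    obtain ⟨h0, hf, -⟩ := isPath_verts (hF _ hent)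
    have hu' := hunique (n x) hnv u hu _ hent (List.mem_of_getElem h) (List.mem_of_getElem hf)
    obtain ⟨h0, hf, -⟩ := isPath_verts (hF u hu)
    have := ((F u).nodup.getElem_inj_iff).1 (h.trans (hu'.symm.trans hf.symm))
    omega
  · rintro x ⟨u, hu, hx⟩
    obtain ⟨i, hi, hix⟩ := List.getElem_of_mem hx
    obtain ⟨d, hd⟩ : ∃ d, d = (F u).verts.length - i := ⟨_, rfl⟩
    induction d generalizing i x with
    | zero => omega
    | succ d ih =>
      by_cases hxv : x = v
      · exact ⟨0, hxv⟩
      obtain ⟨hi', h⟩ := hn x hxv u hu i hi hix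
      obtain ⟨k, hk⟩ := ih (n x) (List.mem_of_getElem h) (i + 1) hi' h (by omega)
      exact ⟨k + 1, hk⟩

theorem IsFlow.isBubble {D : Set (V × V)} {r v : V} {B C : Set V} {n : V → V}
    (h : IsFlow D v B C n) (hr : r ∉ B) : IsBubble D r v B := by
  classical
  set K : V → ℕ := fun u => sInf {k | n^[k] u = v} with hK
  have hKv : ∀ u ∈ C, n^[K u] u = v := fun u hu => Nat.sInf_mem (h.reach u hu)
  have hKlt : ∀ u, ∀ k < K u, n^[k] u ≠ v := fun u k hk => Nat.notMem_of_lt_sInf hk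
  have hC : ∀ u ∈ C, ∀ k ≤ K u, n^[k] u ∈ C := by
    intro u hu k hk
    induction k with
    | zero => exact hu
    | succ k ih =>
      rw [Function.iterate_succ_apply']
      exact h.mem _ (ih (by omega)) (hKlt u k (by omega))
  have hinj : ∀ u ∈ C, ∀ i j, i < j → j ≤ K u → n^[i] u ≠ n^[j] u := by
    intro u hu i j hij hj heq
    refine hKlt u (K u - j + i) (by omega) ?_
    rw [Function.iterate_add_apply, heq, ← Function.iterate_add_apply, Nat.sub_add_cancel hj]
    exact hKv u hu
  have hnodup : ∀ u ∈ C, ((List.range (K u + 1)).map fun k => n^[k] u).Nodup := by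
    intro u hu
    refine List.Nodup.map_on (fun i hi j hj hij => ?_) List.nodup_range
    rw [List.mem_range] at hi hj
    rcases lt_trichotomy i j with hlt | heq | hlt
    · exact absurd hij (hinj u hu i j hlt (by omega))
    · exact heq
    · exact absurd hij.symm (hinj u hu j i hlt (by omega))
  set F : V → DiPath V := fun u => if hu : u ∈ C then
    ⟨(List.range (K u + 1)).map fun k => n^[k] u, by simp, hnodup u hu⟩
    else ⟨[u], by simp, by simp⟩ with hF
  have hFv : ∀ u ∈ C, (F u).verts = (List.range (K u + 1)).map fun k => n^[k] u := fun u hu => by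
    rw [hF]; simp only [dif_pos hu]
  have hset : ∀ u ∈ C, ∀ x, x ∈ (F u).vertexSet ↔ ∃ k ≤ K u, n^[k] u = x := fun u hu x => by
    rw [DiPath.vertexSet, Set.mem_ofPred_eq, hFv u hu]
    rw [List.mem_map]
    simp only [List.mem_range, Nat.lt_succ_iff]
  refine ⟨hr, F, fun u hu => ⟨isPathIn_iff.2 ?_, ?_, ?_⟩, fun u hu u' hu' hne => ?_⟩
  · have huC := h.entrance hu
    rw [hFv u huC, List.isChain_iff_getElem]
    intro i hi
    simp only [List.length_map, List.length_range] at hi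
    simp only [List.getElem_map, List.getElem_range, Function.iterate_succ_apply']
    have h1 := hC u huC i (by omega)
    have h2 := hKlt u i (by omega)
    exact ⟨h.edge _ h1 h2, h.subset h1, h.subset (h.mem _ h1 h2)⟩
  · simp [DiPath.first, List.head_eq_getElem, hFv u (h.entrance hu)]
  · have huC := h.entrance hu
    simp only [DiPath.last, List.getLast_eq_getElem, hFv u huC, List.getElem_map,
      List.getElem_range, List.length_map, List.length_range, Nat.add_sub_cancel, hKv u huC]
  · have huC := h.entrance hu
    have huC' := h.entrance hu'
    have key : ∀ i j, i < K u → j < K u' → n^[i] u ≠ n^[j] u' := by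
      intro i
      induction i with
      | zero =>
        intro j hi hj heq
        rcases j with _ | j
        · exact hne heq
        · rw [Function.iterate_zero_apply, Function.iterate_succ_apply'] at heq
          refine hKlt u 0 hi (heq.trans (h.start _ (hC u' huC' j (by omega))
            (hKlt u' j (by omega)) ?_))
          rwa [← heq]
      | succ i ih =>
        intro j hi hj heq
        have h1 := hC u huC i (by omega)
        have h2 := hKlt u i (by omega)
        have h3 := hKlt u (i + 1) hi
        rcases j with _ | j
        · rw [Function.iterate_zero_apply] at heq
          rw [Function.iterate_succ_apply'] at heq h3
          refine h3 (h.start _ h1 h2 ?_)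
          rwa [heq]
        · rw [Function.iterate_succ_apply'] at heq h3
          rw [Function.iterate_succ_apply'] at heq
          exact ih j (by omega) (by omega) (h.inj _ h1 _ (hC u' huC' j (by omega)) h2
            (hKlt u' j (by omega)) heq h3)
    ext x
    rw [Set.mem_inter_iff, hset u huC, hset u' huC', Set.mem_singleton_iff]
    constructor
    · rintro ⟨⟨i, hi, rfl⟩, j, hj, hij⟩
      by_contra hx
      have hi' : i < K u := lt_of_le_of_ne hi fun h => hx (h ▸ hKv u huC)
      have hj' : j < K u' := lt_of_le_of_ne hj fun h => hx (hij.symm.trans (h ▸ hKv u' huC'))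
      exact key i j hi' hj' hij.symm
    · rintro rfl
      exact ⟨⟨_, le_rfl, hKv u huC⟩, _, le_rfl, hKv u' huC'⟩

theorem isBubble_iUnion {ι : Type*} [LinearOrder ι] [WellFoundedLT ι] [Nonempty ι]
    {D : Set (V × V)} {r v : V} {β : ι → Set V} (hβ : ∀ i, IsBubble D r v (β i)) :
    IsBubble D r v (⋃ i, β i) := by
  classical
  choose C₀ n₀ hflow using fun i => IsBubble.exists_isFlow (hβ i)
  have hsub : ∀ i, β i ⊆ ⋃ i, β i := Set.subset_iUnion β
  have hidx : ∀ x, ∃ i : ι, x ∈ (⋃ i, β i) → x ∈ β i ∧ ∀ j < i, x ∉ β j := by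
    intro x
    by_cases hx : x ∈ (⋃ i, β i)
    · obtain ⟨B, hxB⟩ := Set.mem_iUnion.1 hx
      obtain ⟨i, hi, hmin⟩ := wellFounded_lt.has_min {i : ι | x ∈ β i} ⟨B, hxB⟩
      exact ⟨i, fun _ => ⟨hi, fun j hj hxj => hmin j hxj hj⟩⟩
    · exact ⟨Classical.arbitrary _, fun h => absurd h hx⟩
  choose idx hidx using hidx
  have hle : ∀ x i, x ∈ β i → idx x ≤ i := fun x i hx => by
    by_contra h
    exact (hidx x (hsub i hx)).2 i (not_le.1 h) hx
  have hent : ∀ x i, x ∈ β i → x ∈ entrance D ((⋃ i, β i)) → x ∈ entrance D (β i) :=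
    fun x i hx ⟨_, w, hw, hwx⟩ => ⟨hx, w, fun h => hw (hsub i h), hwx⟩
  set n : V → V := fun x => n₀ (idx x) x with hn
  set C : Set V := {x | x ∈ (⋃ i, β i) ∧ x ∈ C₀ (idx x)} with hC
  have hedge : ∀ x ∈ C, x ≠ v → (x, n x) ∈ D := fun x hx hxv => (hflow _).edge x hx.2 hxv
  have hnmem : ∀ x ∈ C, x ≠ v → n x ∈ C₀ (idx x) := fun x hx hxv => (hflow _).mem x hx.2 hxv
  have hnB : ∀ x ∈ C, x ≠ v → n x ∈ β (idx x) := fun x hx hxv =>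
    (hflow _).subset (hnmem x hx hxv)
  have hnidx : ∀ x ∈ C, x ≠ v → idx (n x) ≤ idx x := fun x hx hxv => hle _ _ (hnB x hx hxv)
  have hentlt : ∀ x ∈ C, x ≠ v → ∀ j < idx x, n x ∈ β j → n x ∈ entrance D (β j) :=
    fun x hx hxv j hj hnj => ⟨hnj, x, (hidx x hx.1).2 j hj, hedge x hx hxv⟩
  have hmem : ∀ x ∈ C, x ≠ v → n x ∈ C := by
    intro x hx hxv
    have hmax := hsub _ (hnB x hx hxv)
    refine ⟨hmax, ?_⟩
    rcases (hnidx x hx hxv).eq_or_lt with h | h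
    · rw [h]
      exact hnmem x hx hxv
    · exact (hflow _).entrance (hentlt x hx hxv _ h (hidx _ hmax).1)
  have hlt : ∀ x ∈ C, ∀ y ∈ C, x ≠ v → y ≠ v → n x = n y → n x ≠ v → ¬ idx x < idx y := by
    intro x hx y hy hxv hyv hxy hnv hlt
    refine hnv ((hflow (idx x)).start x hx.2 hxv ?_)
    have := hentlt y hy hyv (idx x) hlt
    rw [← hxy] at this
    exact this (hnB x hx hxv)
  refine IsFlow.isBubble (C := C) (n := n) ⟨fun x hx => hx.1, ?_, hedge, hmem, ?_, ?_, ?_⟩ ?_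
  · intro x hx
    exact ⟨hx.1, (hflow _).entrance (hent x _ (hidx x hx.1).1 hx)⟩
  · intro x hx y hy hxv hyv hxy hnv
    have h : idx x = idx y := le_antisymm
      (not_lt.1 (hlt y hy x hx hyv hxv hxy.symm (hxy ▸ hnv)))
      (not_lt.1 (hlt x hx y hy hxv hyv hxy hnv))
    refine (hflow (idx x)).inj x hx.2 y (h ▸ hy.2) hxv hyv ?_ hnv
    rw [h]
    rw [hn] at hxy
    simpa only [h] using hxy
  · intro x hx hxv hxe
    exact (hflow (idx x)).start x hx.2 hxv (hent _ _ (hnB x hx hxv) hxe)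
  · have key : ∀ i : ι, ∀ k, ∀ x ∈ C, idx x = i → (n₀ i)^[k] x = v →
        ∃ k, n^[k] x = v := by
      intro i
      induction i using WellFoundedLT.induction with
      | _ i ih =>
        intro k
        induction k with
        | zero => exact fun x _ _ hk => ⟨0, hk⟩
        | succ k ihk =>
          intro x hx hi hk
          by_cases hxv : x = v
          · exact ⟨0, hxv⟩
          have : ∃ k, n^[k] (n x) = v := by
            have hnx := hmem x hx hxv
            rcases (hnidx x hx hxv).eq_or_lt with h | h
            · refine ihk (n x) hnx (h.trans hi) ?_
              rw [Function.iterate_succ_apply] at hk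
              rw [hn]
              simpa only [hi] using hk
            · obtain ⟨k', hk'⟩ := (hflow (idx (n x))).reach _ hnx.2
              exact ih _ (hi ▸ h) k' _ hnx rfl hk'
          obtain ⟨k', hk'⟩ := this
          exact ⟨k' + 1, hk'⟩
    intro x hx
    obtain ⟨k, hk⟩ := (hflow (idx x)).reach x hx.2
    exact key _ k x hx rfl hk
  · rw [Set.mem_iUnion]
    rintro ⟨i, hi⟩
    exact (hβ i).1 hi

/-- The union of all `v`-bubbles is a `v`-bubble. -/
theorem isBubble_maxBubble (D : Set (V × V)) (r v : V) : IsBubble D r v (maxBubble D r v) := by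
  obtain ⟨_, _⟩ := exists_wellFoundedLT (bubbles D r v)
  have : Nonempty (bubbles D r v) := ⟨⟨∅, by simp, fun x => ⟨[x], by simp, by simp⟩,
    fun u hu => absurd hu.1 (by simp), fun u hu => absurd hu.1 (by simp)⟩⟩
  rw [maxBubble, Set.sUnion_eq_iUnion]
  exact isBubble_iUnion fun B : bubbles D r v => B.2

namespace Web

variable {W : Web V}

/-- The web with the additional source `u`, whose ingoing edges are deleted. -/
def addSource (W : Web V) (u : V) : Web V where
  E x y := W.E x y ∧ y ≠ u
  A := W.A ∪ {u}
  B := W.B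
  noIn x y h hy := hy.elim (W.noIn x y h.1) h.2

theorem heads_addSource (I : Set V) (u : V) :
    (W.addSource u).heads I = W.heads I \ {u} := by
  ext y
  constructor
  · rintro ⟨hA, x, hx, hxy⟩
    exact ⟨⟨fun h => hA (Or.inl h), x, hx, hxy.imp_right fun h => h.1⟩, fun h => hA (Or.inr h)⟩
  · rintro ⟨⟨hA, x, hx, hxy⟩, hyu⟩
    exact ⟨fun h => h.elim hA hyu, x, hx, hxy.imp_right fun h => ⟨h, hyu⟩⟩

theorem hindered_or_hit_of_addSource {u : V} (h : (W.addSource u).Hindered) :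
    W.Hindered ∨ W.Hit u := by
  classical
  obtain ⟨I, hne, hI⟩ := h.exists_critical
  by_cases hu : u ∈ W.heads I
  · right
    have hu' := hu
    obtain ⟨huA, x, hx, hxu⟩ := hu'
    obtain ⟨m, hm, hxm⟩ := hI x hx
    rw [heads_addSource] at hxm
    have hmem : ∀ y ∈ W.heads I, y ≠ u → y ∈ (W.addSource u).heads I := fun y hy hyu => by
      rw [heads_addSource]
      exact ⟨hy, hyu⟩
    refine Exists.elim (exists_isWave_of_finite (W := W) (I := I) (D := {u})
      (m := Function.update m u x) hm.avoid ?_ ?_ ?_ (Set.finite_singleton u) ?_)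
      fun m' hm' => ⟨I, m', hm'.1, hu⟩
    · intro y hy
      by_cases hyu : y = u
      · rw [hyu, Function.update_self]
        exact hx
      · rw [Function.update_of_ne hyu]
        exact hm.mem y (hmem y hy hyu)
    · intro y hy
      by_cases hyu : y = u
      · rw [hyu, Function.update_self]
        exact hxu
      · rw [Function.update_of_ne hyu]
        exact (hm.adj y (hmem y hy hyu)).imp_right fun h => h.1
    · intro y hy z hz hyz
      by_cases hyu : y = u <;> by_cases hzu : z = u
      · rw [hyu, hzu]
      · rw [hyu, Function.update_self, Function.update_of_ne hzu] at hyz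
        exact absurd ⟨z, ⟨hz, hzu⟩, hyz.symm⟩ hxm
      · rw [hzu, Function.update_self, Function.update_of_ne hyu] at hyz
        exact absurd ⟨y, ⟨hy, hyu⟩, hyz⟩ hxm
      · rw [Function.update_of_ne hyu, Function.update_of_ne hzu] at hyz
        exact hm.inj (hmem y hy hyu) (hmem z hz hzu) hyz
    · intro y hy
      by_cases hyu : y = u
      · exact Or.inr ⟨0, Or.inr hyu⟩
      · have := (hm.grounded y (hmem y hy hyu)).congr (m' := Function.update m u x) (D := {u})
          fun z hz => by
            by_contra hzu
            exact hz (Function.update_of_ne hzu _ _)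
        have hA : (W.addSource u).A ∪ {u} = W.A ∪ {u} := by
          rw [addSource, Set.union_assoc, Set.union_self]
        rwa [hA] at this
  · left
    obtain ⟨s, hs⟩ := hne
    obtain ⟨m, hm, hsm⟩ := hI s hs
    have heq : (W.addSource u).heads I = W.heads I := by
      rw [heads_addSource, Set.sdiff_singleton_eq_self hu]
    rw [heq] at hsm
    obtain ⟨m', hm', hsub⟩ := exists_isWave_of_finite (W := W) (D := {u}) hm.avoid
      (heq ▸ hm.mem) (fun y hy => (hm.adj y (heq ▸ hy)).imp_right fun h => h.1)
      (heq ▸ hm.inj) (Set.finite_singleton u) (fun y hy => hm.grounded y (heq ▸ hy))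
    exact ⟨I, m', s, hm', hs, fun h => hsm (hsub h)⟩

end Web

/-- The web of reversed edges of `D` outside `K`, from the entrance of `K` to the out-neighbours
of `r`. -/
def entranceWeb (D : Set (V × V)) (r : V) (K : Set V) : Web V where
  E y x := (x, y) ∈ D ∧ x ≠ r ∧ x ∉ K
  A := entrance D K
  B := {x | (r, x) ∈ D}
  noIn _ _ h hy := h.2.2 hy.1

theorem mem_maxBubble_self (D : Set (V × V)) {r v : V} (hv : v ≠ r) : v ∈ maxBubble D r v := by
  refine ⟨{v}, ⟨fun h => hv h.symm, fun _ => ⟨[v], by simp, by simp⟩, ?_, ?_⟩, rfl⟩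
  · rintro u ⟨rfl, -⟩
    exact ⟨by simp [isPathIn_iff], rfl, rfl⟩
  · rintro u ⟨rfl, -⟩ w ⟨rfl, -⟩ h
    exact absurd rfl h

theorem heads_entranceWeb_subset {D : Set (V × V)} {r v : V} (hroot : IsRooted D r) (hv : v ≠ r)
    {I : Set V} {m : V → V}
    (h : (entranceWeb (D \ {(r, v)}) r (maxBubble D r v)).IsWave I m) :
    (entranceWeb (D \ {(r, v)}) r (maxBubble D r v)).heads I ⊆ insert r (maxBubble D r v) := by
  classical
  obtain ⟨C, n, hC⟩ := (isBubble_maxBubble D r v).exists_isFlow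
  have hrK : r ∉ maxBubble D r v := (isBubble_maxBubble D r v).1
  have hvK : v ∈ maxBubble D r v := mem_maxBubble_self D hv
  have hroot' : ∀ x, (x, r) ∉ D := fun x hx => by
    have : (x, r) ∈ inEdges D r := ⟨hx, rfl⟩
    rw [IsRooted] at hroot
    rw [hroot] at this
    exact this
  set K := maxBubble D r v with hK
  set W := entranceWeb (D \ {(r, v)}) r K with hW
  have hA : W.A ⊆ entrance D K := fun x hx => by
    obtain ⟨hxK, w, hw, hwx⟩ := hx
    exact ⟨hxK, w, hw, hwx.1⟩
  -- the additional part of the flow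
  set N : Set V := {y | y ∈ W.heads I ∧ y ∉ K ∧ m y ≠ y} with hN
  set n' : V → V := fun y => if y ∈ N then m y else n y with hn'
  have hE : ∀ y ∈ N, W.E (m y) y := fun y hy => (h.adj y hy.1).resolve_left hy.2.2
  have hNr : ∀ y ∈ N, y ≠ r := fun y hy => (hE y hy).2.1
  have hmN : ∀ y ∈ N, m y ∈ W.A ∨ m y ∈ N := by
    intro y hy
    by_cases hmA : m y ∈ W.A
    · exact Or.inl hmA
    have hmy : m y ∉ K := fun hmK => hmA ⟨hmK, y, hy.2.1, (hE y hy).1⟩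
    have hmh := Web.mem_heads_self (h.mem y hy.1) hmA
    exact Or.inr ⟨hmh, hmy, fun heq => hy.2.2 (h.inj hmh hy.1 heq)⟩
  have hn1 : ∀ y ∈ N, n' y = m y := fun y hy => if_pos hy
  have hn2 : ∀ y ∈ K, n' y = n y := fun y hy => if_neg fun h => h.2.1 hy
  have hCK : ∀ y ∈ C, n' y = n y := fun y hy => hn2 y (hC.subset hy)
  have hAC : ∀ y ∈ W.A, y ∈ C := fun y hy => hC.entrance (hA hy)
  have hNv : ∀ y ∈ N, y ≠ v := fun y hy hyv => hy.2.1 (hyv ▸ hvK)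
  have hbubble : IsBubble D r v (K ∪ (W.heads I \ {r})) := by
    refine IsFlow.isBubble (C := C ∪ N) (n := n') ⟨?_, ?_, ?_, ?_, ?_, ?_, ?_⟩ ?_
    · rintro x (hx | hx)
      · exact Or.inl (hC.subset hx)
      · exact Or.inr ⟨hx.1, hNr x hx⟩
    · rintro y ⟨hy, w, hw, hwy⟩
      have hwK : w ∉ K := fun h => hw (Or.inl h)
      by_cases hyK : y ∈ K
      · exact Or.inl (hC.entrance ⟨hyK, w, hwK, hwy⟩)
      · have hyh := hy.resolve_left hyK
        refine Or.inr ⟨hyh.1, hyK, fun hmy => ?_⟩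
        have hyI : y ∈ I := hmy ▸ h.mem y hyh.1
        have hwy' : (w, y) ∈ D \ {(r, v)} := by
          refine ⟨hwy, fun heq => hyK ?_⟩
          rw [(Prod.mk.inj heq).2]
          exact hvK
        by_cases hwr : w = r
        · rw [hwr] at hwy'
          exact h.avoid y hyI hwy'
        · exact hw (Or.inr ⟨⟨fun hwA => hwK hwA.1, y, hyI, Or.inr ⟨hwy', hwr, hwK⟩⟩, hwr⟩)
    · rintro x (hx | hx) hxv
      · rw [hCK x hx]
        exact hC.edge x hx hxv
      · rw [hn1 x hx]
        exact (hE x hx).1.1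
    · rintro x (hx | hx) hxv
      · rw [hCK x hx]
        exact Or.inl (hC.mem x hx hxv)
      · rw [hn1 x hx]
        exact (hmN x hx).imp_left (hAC _)
    · have mixed : ∀ x ∈ C, ∀ y ∈ N, x ≠ v → n x = m y → n x ≠ v → False := by
        intro x hx y hy hxv hxy hnv
        have hnK := hC.subset (hC.mem x hx hxv)
        rcases hmN y hy with hm | hm
        · exact hnv (hC.start x hx hxv (hxy ▸ hA hm))
        · exact hm.2.1 (hxy ▸ hnK)
      rintro x (hx | hx) y (hy | hy) hxv hyv hxy hnv
      · rw [hCK x hx] at hxy hnv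
        rw [hCK y hy] at hxy
        exact hC.inj x hx y hy hxv hyv hxy hnv
      · rw [hCK x hx] at hxy hnv
        rw [hn1 y hy] at hxy
        exact (mixed x hx y hy hxv hxy hnv).elim
      · rw [hxy, hCK y hy] at hnv
        rw [hn1 x hx, hCK y hy] at hxy
        exact (mixed y hy x hx hyv hxy.symm hnv).elim
      · rw [hn1 x hx, hn1 y hy] at hxy
        exact h.inj hx.1 hy.1 hxy
    · rintro x (hx | hx) hxv hxe
      · rw [hCK x hx] at hxe ⊢
        have hnK := hC.subset (hC.mem x hx hxv)
        obtain ⟨-, w, hw, hwx⟩ := hxe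
        exact hC.start x hx hxv ⟨hnK, w, fun h => hw (Or.inl h), hwx⟩
      · rw [hn1 x hx] at hxe ⊢
        by_contra hmv
        obtain ⟨-, w, hw, hwx⟩ := hxe
        have hwK : w ∉ K := fun h => hw (Or.inl h)
        by_cases hwr : w = r
        · rw [hwr] at hwx
          exact h.avoid _ (h.mem x hx.1) ⟨hwx, fun heq => hmv (Prod.mk.inj heq).2⟩
        · exact hw (Or.inr ⟨⟨fun hwA => hwK hwA.1, m x, h.mem x hx.1,
            Or.inr ⟨⟨hwx, fun heq => hwr (Prod.mk.inj heq).1⟩, hwr, hwK⟩⟩, hwr⟩)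
    · have hreachC : ∀ k, ∀ x ∈ C, n^[k] x = v → ∃ k, n'^[k] x = v := by
        intro k
        induction k with
        | zero => exact fun x _ hk => ⟨0, hk⟩
        | succ k ih =>
          intro x hx hk
          by_cases hxv : x = v
          · exact ⟨0, hxv⟩
          obtain ⟨k', hk'⟩ := ih (n x) (hC.mem x hx hxv) hk
          exact ⟨k' + 1, by rwa [Function.iterate_succ_apply, hCK x hx]⟩
      have hreachN : ∀ k, ∀ x ∈ N, m^[k] x ∈ W.A → ∃ k, n'^[k] x = v := by
        intro k
        induction k with
        | zero => exact fun x hx hk => absurd hk.1 hx.2.1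
        | succ k ih =>
          intro x hx hk
          have : ∃ k, n'^[k] (m x) = v := by
            rcases hmN x hx with hm | hm
            · obtain ⟨j, hj⟩ := hC.reach _ (hAC _ hm)
              exact hreachC j _ (hAC _ hm) hj
            · exact ih _ hm hk
          obtain ⟨k', hk'⟩ := this
          exact ⟨k' + 1, by rwa [Function.iterate_succ_apply, hn1 x hx]⟩
      rintro x (hx | hx)
      · obtain ⟨k, hk⟩ := hC.reach x hx
        exact hreachC k x hx hk
      · obtain ⟨k, hk⟩ := (h.grounded x hx.1).resolve_left hx.2.2
        exact hreachN k x hx hk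
    · rintro (hr | hr)
      · exact hrK hr
      · exact hr.2 rfl
  intro y hy
  by_cases hyr : y = r
  · exact Or.inl hyr
  · exact Or.inr (Set.subset_sUnion_of_mem (S := bubbles D r v) hbubble (Or.inr ⟨hy, hyr⟩))

theorem not_hindered_entranceWeb {D : Set (V × V)} {r v : V} (hroot : IsRooted D r)
    (hv : v ≠ r) : ¬ (entranceWeb (D \ {(r, v)}) r (maxBubble D r v)).Hindered := by
  rintro ⟨I, m, s, h, hs, hsm⟩
  have hsub := heads_entranceWeb_subset hroot hv h
  by_cases hsA : s ∈ (entranceWeb (D \ {(r, v)}) r (maxBubble D r v)).A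
  · obtain ⟨hsK, x, hxK, hxs⟩ := hsA
    by_cases hxr : x = r
    · rw [hxr] at hxs
      exact h.avoid s hs hxs
    · exact (hsub ⟨fun hxA => hxK hxA.1, s, hs, Or.inr ⟨hxs, hxr, hxK⟩⟩).elim hxr hxK
  · have hsh := Web.mem_heads_self hs hsA
    have hE := (h.adj s hsh).resolve_left fun heq => hsm ⟨s, hsh, heq⟩
    exact (hsub hsh).elim hE.2.1 hE.2.2

theorem isPathIn_cons_reverse {D : Set (V × V)} {r : V} {l : List V} {b : V}
    (hl : l.IsChain fun x y => (y, x) ∈ D) (hb : l.getLast? = some b) (hrb : (r, b) ∈ D)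
    (hnd : (r :: l.reverse).Nodup) : IsPathIn D ⟨r :: l.reverse, by simp, hnd⟩ := by
  rw [isPathIn_iff]
  refine List.isChain_cons.2 ⟨fun y hy => ?_, List.isChain_reverse.2 hl⟩
  rw [List.head?_reverse, hb] at hy
  obtain rfl := Option.some.inj hy
  exact hrb

theorem exists_rFan {D : Set (V × V)} {r : V} {A : Set V} (L : V → List V)
    (hchain : ∀ a ∈ A, (L a).IsChain fun x y => (y, x) ∈ D) (hnd : ∀ a ∈ A, (L a).Nodup)
    (hhead : ∀ a ∈ A, (L a).head? = some a)
    (hlast : ∀ a ∈ A, ∃ b, (r, b) ∈ D ∧ (L a).getLast? = some b) (hr : ∀ a ∈ A, r ∉ L a)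
    (hdisj : ∀ a ∈ A, ∀ a' ∈ A, a ≠ a' → List.Disjoint (L a) (L a')) :
    ∃ Ps, IsRFan D r Ps ∧ Vlast Ps = A := by
  have hnd' : ∀ a : A, (r :: (L a).reverse).Nodup := fun a =>
    List.nodup_cons.2 ⟨by simpa using hr a a.2, List.nodup_reverse.2 (hnd a a.2)⟩
  set P : A → DiPath V := fun a => ⟨r :: (L a).reverse, by simp, hnd' a⟩ with hP
  have hPlast : ∀ a : A, (P a).last = a := by
    intro a
    have h : (r :: (L a).reverse).getLast? = some (a : V) := by
      rw [List.getLast?_cons, List.getLast?_reverse, hhead a a.2]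
      rfl
    exact Option.some.inj ((List.getLast?_eq_some_getLast _).symm.trans h)
  have hmem : ∀ a x, x ∈ (P a).vertexSet ↔ x = r ∨ x ∈ L a := fun a x => by
    simp [hP, DiPath.vertexSet]
  refine ⟨Set.range P, ⟨?_, ?_⟩, ?_⟩
  · rintro _ ⟨a, rfl⟩
    obtain ⟨b, hb, hab⟩ := hlast a a.2
    exact ⟨isPathIn_cons_reverse (hchain a a.2) hab hb (hnd' a), rfl⟩
  · rintro _ ⟨a, rfl⟩ _ ⟨a', rfl⟩ hne
    have haa' : (a : V) ≠ a' := fun h => hne (congrArg P (Subtype.ext h))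
    ext x
    rw [Set.mem_inter_iff, hmem, hmem, Set.mem_singleton_iff]
    constructor
    · rintro ⟨hx | hx, hx' | hx'⟩
      · exact hx
      · exact hx
      · exact hx'
      · exact (hdisj a a.2 a' a'.2 haa' hx hx').elim
    · exact fun hx => ⟨Or.inl hx, Or.inl hx⟩
  · ext x
    constructor
    · rintro ⟨_, ⟨a, rfl⟩, rfl⟩
      rw [hPlast]
      exact a.2
    · exact fun hx => ⟨_, ⟨⟨x, hx⟩, rfl⟩, hPlast _⟩

/-- For every `v ∈ V − r` and `u ∈ (V ∖ B_{v,D}) − r`, there is an `r`-fan in `D−rv`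
whose set of last vertices is `ent_{D−rv}(B_{v,D}) + u`. -/
theorem one_more_path {V : Type u} [Infinite V] (r : V) (D : Set (V × V))
    (hroot : IsRooted D r) (v : V) (hv : v ≠ r) (u : V)
    (hu : u ∉ maxBubble D r v) (hur : u ≠ r) :
    ∃ Ps, IsRFan (D \ {(r, v)}) r Ps ∧
      Vlast Ps = entrance (D \ {(r, v)}) (maxBubble D r v) ∪ {u} := by
  set W := entranceWeb (D \ {(r, v)}) r (maxBubble D r v) with hW
  have hnot : ¬ (W.addSource u).Hindered := by
    intro h
    rcases Web.hindered_or_hit_of_addSource h with h | ⟨I, m, hm, huI⟩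
    · exact not_hindered_entranceWeb hroot hv h
    · exact (heads_entranceWeb_subset hroot hv hm huI).elim hur hu
  obtain ⟨L, hL⟩ := Web.linked_univ hnot
  have hlink := fun a ha => (hL a ha (Set.mem_univ a)).1
  refine exists_rFan L (fun a ha => (hlink a ha).chain.imp fun _ _ h => h.1.1)
    (fun a ha => (hlink a ha).nodup) (fun a ha => (hlink a ha).head)
    (fun a ha => (hlink a ha).last) (fun a ha hra => ?_)
    fun a ha a' ha' => (hL a ha (Set.mem_univ a)).2.2 a' ha' (Set.mem_univ a')
  rcases (hlink a ha).mem_cases hra with h | ⟨y, hy⟩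
  · rw [← h] at ha
    exact ha.elim (fun h => (isBubble_maxBubble D r v).1 h.1) fun h => hur h.symm
  · exact hy.1.2.1 rfl

end FlamePaper
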